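/- The reduced integral homology group H̃_4(M_14; ℤ) of the matching complex on 14 vertices is a finite group whose exponent is a multiple of 15. In particular, H̃_4(M_14; ℤ) contains elements of order 3 and elements of order 5. -/

import Mathlib

set_option synthInstance.maxHeartbeats 1000000
set_option maxHeartbeats 1000000

noncomputable section

namespace MatchPaper

attribute [local instance 10] Classical.propDecidable

/-! ### Guarded constructions on additive groups -/

section AddGadgets

variable {A B : Type*} [AddCommGroup A] [AddCommGroup B]

/-- Lift a homomorphism to the quotient (it genuinely descends whenever it kills `S`). -/
def liftOrZero (S : AddSubgroup A) (f : A →+ B) : A ⧸ S →+ B :=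
  if h : S ≤ f.ker then QuotientAddGroup.lift S f h else 0

/-- Descend a homomorphism to quotients (genuine whenever `f S ≤ T`). -/
def descend (S : AddSubgroup A) (T : AddSubgroup B) (f : A →+ B) : A ⧸ S →+ B ⧸ T :=
  if h : S ≤ T.comap f then QuotientAddGroup.map S T f h else 0

/-- Restrict a homomorphism to subgroups (genuine whenever `f Z ≤ Z'`). -/
def restrictHom (f : A →+ B) (Z : AddSubgroup A) (Z' : AddSubgroup B) : Z →+ Z' :=
  if h : ∀ x : Z, f x ∈ Z' then (f.comp Z.subtype).codRestrict Z' (fun x => h x) else 0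

/-- The subquotient `Z / (Bd ∩ Z)`. -/
abbrev subQuot (Z Bd : AddSubgroup A) : Type _ := Z ⧸ Bd.addSubgroupOf Z

/-- The map induced by `f` on subquotients. -/
def subQuotMap (f : A →+ B) (Z Bd : AddSubgroup A) (Z' Bd' : AddSubgroup B) :
    subQuot Z Bd →+ subQuot Z' Bd' :=
  descend (Bd.addSubgroupOf Z) (Bd'.addSubgroupOf Z') (restrictHom f Z Z')

end AddGadgets

/-! ### Chain complexes of abelian groups, group actions, quotient and fixed-difference
subcomplexes, and homology -/

section Abstract

variable (X : ℤ → Type*) [∀ i, AddCommGroup (X i)]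

/-- Transport along an equality of indices. -/
def castAE {i j : ℤ} (h : i = j) : X i ≃+ X j := by subst h; exact AddEquiv.refl _

variable (d : ∀ i : ℤ, X (i + 1) →+ X i)

/-- The boundary map leaving degree `i`. -/
def dfrom (i : ℤ) : X i →+ X (i - 1) :=
  (d (i - 1)).comp (castAE X (show i = (i - 1) + 1 by ring)).toAddMonoidHom

/-- Cycles in degree `i`. -/
def cyc (i : ℤ) : AddSubgroup (X i) := (dfrom X d i).ker

/-- Boundaries in degree `i`. -/
def bdr (i : ℤ) : AddSubgroup (X i) := (d i).range

/-- Homology of the chain complex `(X, d)` in degree `i`. -/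
abbrev Hgrp (i : ℤ) : Type _ := subQuot (cyc X d i) (bdr X d i)

variable {G : Type*} [Group G] (act : G → ∀ i : ℤ, X i ≃+ X i)

/-- The subgroup `C_i^G` generated by the elements `c - g c`. -/
def gsub (i : ℤ) : AddSubgroup (X i) :=
  AddSubgroup.closure {x | ∃ (c : X i) (g : G), x = c - act g i c}

/-- The degree-`i` part of the quotient complex `C/G`. -/
abbrev QX (i : ℤ) : Type _ := X i ⧸ gsub X act i

/-- The boundary map of the quotient complex `C/G`. -/
def qd (i : ℤ) : QX X act (i + 1) →+ QX X act i :=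
  descend (gsub X act (i + 1)) (gsub X act i) (d i)

/-- Homology of the quotient complex `C/G`. -/
abbrev HQgrp (i : ℤ) : Type _ := Hgrp (QX X act) (qd X d act) i

/-- The boundary map of the subcomplex `C^G`. -/
def sd (i : ℤ) : gsub X act (i + 1) →+ gsub X act i :=
  restrictHom (d i) (gsub X act (i + 1)) (gsub X act i)

/-- Homology of the subcomplex `C^G`. -/
abbrev HSgrp (i : ℤ) : Type _ := Hgrp (fun j => gsub X act j) (sd X d act) i

/-- The projection chain map `C → C/G`. -/
def projX (i : ℤ) : X i →+ QX X act i := QuotientAddGroup.mk' _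

/-- The map `π*` induced on homology by the projection `C → C/G`. -/
def piStar (i : ℤ) : Hgrp X d i →+ HQgrp X d act i :=
  subQuotMap (projX X act i) (cyc X d i) (bdr X d i)
    (cyc (QX X act) (qd X d act) i) (bdr (QX X act) (qd X d act) i)

/-- The chain map `φ : C/G → C`, `[c] ↦ ∑ g • c`. -/
def phiX [Fintype G] (i : ℤ) : QX X act i →+ X i :=
  liftOrZero (gsub X act i) (∑ g : G, (act g i).toAddMonoidHom)

/-- The map `φ*` induced on homology by `φ`. -/
def phiStar [Fintype G] (i : ℤ) : HQgrp X d act i →+ Hgrp X d i :=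
  subQuotMap (phiX X act i) (cyc (QX X act) (qd X d act) i) (bdr (QX X act) (qd X d act) i)
    (cyc X d i) (bdr X d i)

end Abstract

/-! ### Guarded constructions on modules -/

section LinGadgets

variable (R : Type*) [CommRing R] {M N : Type*} [AddCommGroup M] [Module R M]
  [AddCommGroup N] [Module R N]

def liftOrZeroL (S : Submodule R M) (f : M →ₗ[R] N) : (M ⧸ S) →ₗ[R] N :=
  if h : S ≤ LinearMap.ker f then S.liftQ f h else 0

def descendL (S : Submodule R M) (T : Submodule R N) (f : M →ₗ[R] N) :
    (M ⧸ S) →ₗ[R] (N ⧸ T) :=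
  if h : S ≤ T.comap f then S.mapQ T f h else 0

def restrictL (f : M →ₗ[R] N) (Z : Submodule R M) (Z' : Submodule R N) : Z →ₗ[R] Z' :=
  if h : ∀ x ∈ Z, f x ∈ Z' then f.restrict h else 0

/-- The subquotient `Z / (Bd ∩ Z)`. -/
abbrev subQuotL (Z Bd : Submodule R M) : Type _ := Z ⧸ Bd.comap Z.subtype

def subQuotMapL (f : M →ₗ[R] N) (Z Bd : Submodule R M) (Z' Bd' : Submodule R N) :
    subQuotL R Z Bd →ₗ[R] subQuotL R Z' Bd' :=
  descendL R (Bd.comap Z.subtype) (Bd'.comap Z'.subtype) (restrictL R f Z Z')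

end LinGadgets

/-! ### Reduced simplicial chains and homology of a family of finite sets

A family `K : Finset V → Prop` of finite subsets of a vertex type `V` (in our applications a
simplicial complex, in particular closed under taking subsets and containing `∅`) has reduced
simplicial chain groups over a ring `R`: the degree-`d` chain group is free on the faces of
cardinality `d + 1`, i.e. we index chain groups by the cardinality `c = d + 1` of the faces,
with the empty face (cardinality `0`, degree `-1`) giving the augmentation.  Orientations are
induced by an injection `rank : V → ℕ` of the vertices into `ℕ`. -/

section Simplicial

variable (R : Type*) [CommRing R]

/-- Chains on the faces of cardinality `c` of the family `K`. -/
abbrev SChain {V : Type*} (K : Finset V → Prop) (c : ℕ) : Type _ :=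
  {σ : Finset V // K σ ∧ σ.card = c} →₀ R

/-- The basis chain of a face, or zero for a non-face. -/
def basisOrZero {V : Type*} (K : Finset V → Prop) (c : ℕ) (τ : Finset V) : SChain R K c :=
  if h : K τ ∧ τ.card = c then Finsupp.single ⟨τ, h⟩ (1 : R) else 0

/-- The simplicial boundary map, with signs determined by the ordering of the vertices via
`rank`. -/
def bdry {V : Type*} [DecidableEq V] (rank : V → ℕ) (K : Finset V → Prop) (c : ℕ) :
    SChain R K (c + 1) →ₗ[R] SChain R K c :=
  Finsupp.lsum R fun σ => LinearMap.toSpanSingleton R _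
    (∑ v ∈ σ.1, ((-1 : ℤ) ^ ((σ.1.filter fun u => rank u < rank v).card) •
      basisOrZero R K c (σ.1.erase v)))

/-- The orientation sign of a map `f` on a face `σ`: the parity of the number of inversions. -/
def mapSign {V W : Type*} (rank : V → ℕ) (rank' : W → ℕ) (f : V → W) (σ : Finset V) : ℤ :=
  (-1) ^ (((σ ×ˢ σ).filter fun p => rank p.1 < rank p.2 ∧ rank' (f p.2) < rank' (f p.1)).card)

/-- The chain map induced by a map `f` on vertices, taking orientations into account. -/
def chainMap {V W : Type*} [DecidableEq V] [DecidableEq W] (rank : V → ℕ) (rank' : W → ℕ)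
    (f : V → W) (K : Finset V → Prop) (K' : Finset W → Prop) (c : ℕ) :
    SChain R K c →ₗ[R] SChain R K' c :=
  Finsupp.lsum R fun σ => LinearMap.toSpanSingleton R _
    (mapSign rank rank' f σ.1 • basisOrZero R K' c (σ.1.image f))

/-- Cycles among the chains on faces of cardinality `c` (for `c = 0` everything is a cycle:
the boundary map leaving degree `-1` is zero). -/
def cycLow {V : Type*} [DecidableEq V] (rank : V → ℕ) (K : Finset V → Prop) :
    (c : ℕ) → Submodule R (SChain R K c)
  | 0 => ⊤
  | (m + 1) => LinearMap.ker (bdry R rank K m)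

/-- Reduced simplicial homology at the faces of cardinality `c`, i.e. in degree `c - 1`. -/
abbrev RHc {V : Type*} [DecidableEq V] (rank : V → ℕ) (K : Finset V → Prop) (c : ℕ) : Type _ :=
  subQuotL R (cycLow R rank K c) (LinearMap.range (bdry R rank K c))

/-- Reduced simplicial homology `H̃_dg(K; R)`. -/
abbrev RH {V : Type*} [DecidableEq V] (rank : V → ℕ) (K : Finset V → Prop) (dg : ℕ) : Type _ :=
  RHc R rank K (dg + 1)

end Simplicial

/-! ### The matching complex and the complexes of graphs of bounded degree -/

/-- The standard injection of pairs into `ℕ`, inducing the lexicographic order. -/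
def rankP (m : ℕ) : Fin m × Fin m → ℕ := fun p => p.1.val * m + p.2.val

/-- A face of the matching complex `M_m`: a set of edges `(i, j)`, `i < j`, of the complete
graph on `Fin m`, no two of which share an endpoint. -/
def IsMatching (m : ℕ) (σ : Finset (Fin m × Fin m)) : Prop :=
  (∀ p ∈ σ, p.1 < p.2) ∧
    ∀ p ∈ σ, ∀ q ∈ σ, p ≠ q → p.1 ≠ q.1 ∧ p.1 ≠ q.2 ∧ p.2 ≠ q.1 ∧ p.2 ≠ q.2

/-- `H̃_dg(M_m; R)`, the reduced homology of the matching complex on `m` vertices. -/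
abbrev MH (R : Type*) [CommRing R] (m dg : ℕ) : Type _ := RH R (rankP m) (IsMatching m) dg

/-- The degree of the vertex `i` in the graph `σ` (a loop `(i, i)` counts twice). -/
def degB {n : ℕ} (σ : Finset (Fin n × Fin n)) (i : Fin n) : ℕ :=
  ∑ p ∈ σ, ((if p.1 = i then 1 else 0) + (if p.2 = i then 1 else 0))

/-- A face of `BD_n^λ`: a graph on `Fin n` (loops allowed, encoded as pairs `(i, j)` with
`i ≤ j`) in which the vertex `i` has degree at most `λ i`. -/
def IsBDGraph {n : ℕ} (lam : Fin n → ℕ) (σ : Finset (Fin n × Fin n)) : Prop :=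
  (∀ p ∈ σ, p.1 ≤ p.2) ∧ ∀ i, degB σ i ≤ lam i

/-- `H̃_dg(BD_n^λ; R)`. -/
abbrev BDH (R : Type*) [CommRing R] {n : ℕ} (lam : Fin n → ℕ) (dg : ℕ) : Type _ :=
  RH R (rankP n) (IsBDGraph lam) dg

/-! ### The Young group action on the matching complex -/

/-- The action of a permutation of the vertices on the edges of the complete graph. -/
def emap {m : ℕ} (g : Equiv.Perm (Fin m)) : Fin m × Fin m → Fin m × Fin m :=
  fun p => (min (g p.1) (g p.2), max (g p.1) (g p.2))

/-- The quotient map on edges induced by a surjection `kap` on vertices (whose fibers are the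
blocks `U_i` of the partition). -/
def kmap {N n : ℕ} (kap : Fin N → Fin n) : Fin N × Fin N → Fin n × Fin n :=
  fun p => (min (kap p.1) (kap p.2), max (kap p.1) (kap p.2))

/-- Membership of a permutation in the Young group: it preserves each block of the partition
determined by `kap`. -/
def KeepsBlocks {N n : ℕ} (kap : Fin N → Fin n) (g : Equiv.Perm (Fin N)) : Prop :=
  ∀ x, kap (g x) = kap x

section YoungAction

variable (R : Type*) [CommRing R]

/-- The action of a permutation `g` of the `N` vertices on chains. -/
def actC (N : ℕ) (K : Finset (Fin N × Fin N) → Prop) (g : Equiv.Perm (Fin N)) (c : ℕ) :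
    SChain R K c →ₗ[R] SChain R K c :=
  chainMap R (rankP N) (rankP N) (emap g) K K c

/-- The submodule of chains generated by the elements `c - g c`, `g` in the Young group. -/
def ysub (N n : ℕ) (kap : Fin N → Fin n) (K : Finset (Fin N × Fin N) → Prop) (c : ℕ) :
    Submodule R (SChain R K c) :=
  Submodule.span R {x | ∃ (ch : SChain R K c) (g : Equiv.Perm (Fin N)),
    KeepsBlocks kap g ∧ x = ch - actC R N K g c ch}

/-- The chains of the quotient complex `C̃/S_λ`. -/
abbrev QC (N n : ℕ) (kap : Fin N → Fin n) (K : Finset (Fin N × Fin N) → Prop) (c : ℕ) :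
    Type _ :=
  SChain R K c ⧸ ysub R N n kap K c

/-- The boundary map of the quotient complex `C̃/S_λ`. -/
def qbdry (N n : ℕ) (kap : Fin N → Fin n) (K : Finset (Fin N × Fin N) → Prop) (c : ℕ) :
    QC R N n kap K (c + 1) →ₗ[R] QC R N n kap K c :=
  descendL R (ysub R N n kap K (c + 1)) (ysub R N n kap K c) (bdry R (rankP N) K c)

/-- Homology of the quotient complex `C̃(M_N)/S_λ` in degree `dg`. -/
abbrev QMH (N n : ℕ) (kap : Fin N → Fin n) (dg : ℕ) : Type _ :=
  subQuotL R (LinearMap.ker (qbdry R N n kap (IsMatching N) dg))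
    (LinearMap.range (qbdry R N n kap (IsMatching N) (dg + 1)))

/-- The chain map `φ : C̃/S_λ → C̃`, `[c] ↦ ∑_{g ∈ S_λ} g c`. -/
def phiC (N n : ℕ) (kap : Fin N → Fin n) (K : Finset (Fin N × Fin N) → Prop) (c : ℕ) :
    QC R N n kap K c →ₗ[R] SChain R K c :=
  liftOrZeroL R (ysub R N n kap K c)
    (∑ g ∈ Finset.univ.filter (fun g : Equiv.Perm (Fin N) => ∀ x, kap (g x) = kap x),
      actC R N K g c)

/-- The map `φ* : H_dg(C̃(M_N)/S_λ) → H̃_dg(M_N; R)` induced by `φ`. -/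
def phiStarM (N n : ℕ) (kap : Fin N → Fin n) (dg : ℕ) :
    QMH R N n kap dg →ₗ[R] MH R N dg :=
  subQuotMapL R (phiC R N n kap (IsMatching N) (dg + 1))
    (LinearMap.ker (qbdry R N n kap (IsMatching N) dg))
    (LinearMap.range (qbdry R N n kap (IsMatching N) (dg + 1)))
    (cycLow R (rankP N) (IsMatching N) (dg + 1))
    (LinearMap.range (bdry R (rankP N) (IsMatching N) (dg + 1)))

end YoungAction

/-! ### The subfamilies `Δ_λ` and `Γ_λ` of the matching complex -/

/-- `σ` contains two distinct edges `ab`, `cd` with `a, c` in the same block and `b, d` in the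
same block. -/
def InDelta {N n : ℕ} (kap : Fin N → Fin n) (σ : Finset (Fin N × Fin N)) : Prop :=
  ∃ p ∈ σ, ∃ q ∈ σ, p ≠ q ∧
    ((kap p.1 = kap q.1 ∧ kap p.2 = kap q.2) ∨ (kap p.1 = kap q.2 ∧ kap p.2 = kap q.1))

/-- A face of `Δ_λ`. -/
def IsDelta {N n : ℕ} (kap : Fin N → Fin n) (σ : Finset (Fin N × Fin N)) : Prop :=
  IsMatching N σ ∧ InDelta kap σ

/-- A face of `Γ_λ = M_N \ Δ_λ`. -/
def IsGamma {N n : ℕ} (kap : Fin N → Fin n) (σ : Finset (Fin N × Fin N)) : Prop :=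
  IsMatching N σ ∧ ¬ InDelta kap σ

section YoungMore

variable (R : Type*) [CommRing R]

/-- The map `κ̂ : C̃(Γ_λ)/S_λ → C̃(BD_n^λ)`, `[c] ↦ κ(c)`. -/
def khat (N n : ℕ) (kap : Fin N → Fin n) (lam : Fin n → ℕ) (c : ℕ) :
    QC R N n kap (IsGamma kap) c →ₗ[R] SChain R (IsBDGraph lam) c :=
  liftOrZeroL R (ysub R N n kap (IsGamma kap) c)
    (chainMap R (rankP N) (rankP n) (kmap kap) (IsGamma kap) (IsBDGraph lam) c)

/-- The boundary map of the subcomplex `C̃(M_N; R)^{S_λ}`. -/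
def sbdry (N n : ℕ) (kap : Fin N → Fin n) (c : ℕ) :
    ysub R N n kap (IsMatching N) (c + 1) →ₗ[R] ysub R N n kap (IsMatching N) c :=
  restrictL R (bdry R (rankP N) (IsMatching N) c)
    (ysub R N n kap (IsMatching N) (c + 1)) (ysub R N n kap (IsMatching N) c)

/-- Homology of the subcomplex `C̃(M_N; R)^{S_λ}` in degree `dg`: the cycles of the
subcomplex (elements of the subcomplex with vanishing boundary) modulo the boundaries of
elements of the subcomplex. -/
abbrev SubH (N n : ℕ) (kap : Fin N → Fin n) (dg : ℕ) : Type _ :=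
  subQuotL R
    (ysub R N n kap (IsMatching N) (dg + 1) ⊓ cycLow R (rankP N) (IsMatching N) (dg + 1))
    ((ysub R N n kap (IsMatching N) (dg + 1 + 1)).map (bdry R (rankP N) (IsMatching N) (dg + 1)))

/-! ### Inclusion maps between matching complexes -/

/-- The chain map induced by the inclusion `M_m ⊆ M_{m'}`. -/
def inclChain (m m' : ℕ) (h : m ≤ m') (c : ℕ) :
    SChain R (IsMatching m) c →ₗ[R] SChain R (IsMatching m') c :=
  chainMap R (rankP m) (rankP m') (fun p => (Fin.castLE h p.1, Fin.castLE h p.2))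
    (IsMatching m) (IsMatching m') c

/-- The map `H̃_dg(M_m; R) → H̃_dg(M_{m'}; R)` induced by the inclusion. -/
def inclStar (m m' : ℕ) (h : m ≤ m') (dg : ℕ) : MH R m dg →ₗ[R] MH R m' dg :=
  subQuotMapL R (inclChain R m m' h (dg + 1))
    (cycLow R (rankP m) (IsMatching m) (dg + 1))
    (LinearMap.range (bdry R (rankP m) (IsMatching m) (dg + 1)))
    (cycLow R (rankP m') (IsMatching m') (dg + 1))
    (LinearMap.range (bdry R (rankP m') (IsMatching m') (dg + 1)))

/-! ### The pair `(M_m, M_m \ e)`, where `e` is the last edge -/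

/-- The edge `e` between the last two of the `m` vertices. -/
def eEdge (m : ℕ) (h : 2 ≤ m) : Fin m × Fin m := (⟨m - 2, by omega⟩, ⟨m - 1, by omega⟩)

/-- A face of `M_m \ e`: a matching not containing the edge `e`. -/
def MnMinusE (m : ℕ) (h : 2 ≤ m) (σ : Finset (Fin m × Fin m)) : Prop :=
  IsMatching m σ ∧ eEdge m h ∉ σ

/-- Pass from a set of edges avoiding the last two vertices of `Fin m` to a set of edges on
`Fin (m - 2)`. -/
def shrink (m : ℕ) (σ : Finset (Fin m × Fin m)) : Finset (Fin (m - 2) × Fin (m - 2)) :=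
  (σ.filter fun p => p.1.val < m - 2 ∧ p.2.val < m - 2).attach.image
    fun p => (⟨p.1.1.val, (Finset.mem_filter.mp p.2).2.1⟩,
              ⟨p.1.2.val, (Finset.mem_filter.mp p.2).2.2⟩)

/-- The chain map realizing the composition
`C̃(M_m) → C̃(M_m, M_m \ e) ≅ C̃(M_{m - 2})[1]`: a face `σ` containing `e` is written as
`σ = ± e ∧ w` and sent to `± w`, viewed in the matching complex on the remaining `m - 2`
vertices; a face not containing `e` is sent to zero. -/
def theta (m : ℕ) (hm : 2 ≤ m) (c : ℕ) :
    SChain R (IsMatching m) (c + 1) →ₗ[R] SChain R (IsMatching (m - 2)) c :=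
  Finsupp.lsum R fun σ => LinearMap.toSpanSingleton R _
    (if eEdge m hm ∈ σ.1 then
      ((-1 : ℤ) ^ c) • basisOrZero R (IsMatching (m - 2)) c (shrink m (σ.1.erase (eEdge m hm)))
     else 0)

/-- The map `H̃_dg(M_m \ e; R) → H̃_dg(M_m; R)` induced by the inclusion. -/
def inclEStar (m : ℕ) (hm : 2 ≤ m) (dg : ℕ) :
    RH R (rankP m) (MnMinusE m hm) dg →ₗ[R] MH R m dg :=
  subQuotMapL R (chainMap R (rankP m) (rankP m) id (MnMinusE m hm) (IsMatching m) (dg + 1))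
    (cycLow R (rankP m) (MnMinusE m hm) (dg + 1))
    (LinearMap.range (bdry R (rankP m) (MnMinusE m hm) (dg + 1)))
    (cycLow R (rankP m) (IsMatching m) (dg + 1))
    (LinearMap.range (bdry R (rankP m) (IsMatching m) (dg + 1)))

/-- The composition `H̃_dg(M_m; R) → H_dg(M_m, M_m \ e; R) ≅ H̃_{dg - 1}(M_{m - 2}; R)` of the
map to relative homology with the canonical isomorphism. -/
def thetaStar (m : ℕ) (hm : 2 ≤ m) (dg : ℕ) :
    MH R m dg →ₗ[R] RHc R (rankP (m - 2)) (IsMatching (m - 2)) dg :=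
  subQuotMapL R (theta R m hm dg)
    (cycLow R (rankP m) (IsMatching m) (dg + 1))
    (LinearMap.range (bdry R (rankP m) (IsMatching m) (dg + 1)))
    (cycLow R (rankP (m - 2)) (IsMatching (m - 2)) dg)
    (LinearMap.range (bdry R (rankP (m - 2)) (IsMatching (m - 2)) dg))

end YoungMore

end MatchPaper

end
/-! ### The exterior algebra of a set with ranked elements, as an explicit free module -/

namespace M14

noncomputable section

/-- The exterior algebra on `E`, free on the finite subsets of `E`. -/
abbrev TT (E : Type*) := Finset E →₀ ℤ

section Ext

variable {E : Type*} [DecidableEq E] (rk : E → ℕ)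

/-- Sign of moving `e` to its place in `σ`. -/
def sg1 (e : E) (σ : Finset E) : ℤ := (-1) ^ ((σ.filter fun u => rk u < rk e).card)

/-- Left multiplication by `e`. -/
def W (e : E) : TT E →ₗ[ℤ] TT E :=
  Finsupp.lsum ℤ fun σ => LinearMap.toSpanSingleton ℤ _
    (if e ∈ σ then 0 else sg1 rk e σ • Finsupp.single (insert e σ) (1 : ℤ))

/-- Contraction with the linear functional `φ`. -/
def D (φ : E → ℤ) : TT E →ₗ[ℤ] TT E :=
  Finsupp.lsum ℤ fun σ => LinearMap.toSpanSingleton ℤ _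
    (∑ v ∈ σ, (φ v * sg1 rk v σ) • Finsupp.single (σ.erase v) (1 : ℤ))

/-- The boundary map. -/
abbrev dd : TT E →ₗ[ℤ] TT E := D rk fun _ => 1

lemma W_single (e : E) (σ : Finset E) : W rk e (Finsupp.single σ 1) =
    if e ∈ σ then 0 else sg1 rk e σ • Finsupp.single (insert e σ) (1 : ℤ) := by
  simp [W]

lemma D_single (φ : E → ℤ) (σ : Finset E) : D rk φ (Finsupp.single σ 1) =
    ∑ v ∈ σ, (φ v * sg1 rk v σ) • Finsupp.single (σ.erase v) (1 : ℤ) := by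
  simp [D]

lemma sg1_sq (e : E) (σ : Finset E) : sg1 rk e σ * sg1 rk e σ = 1 := by
  unfold sg1; rw [← mul_pow]; simp

lemma sg1_cases (e : E) (σ : Finset E) : sg1 rk e σ = 1 ∨ sg1 rk e σ = -1 :=
  neg_one_pow_eq_or ℤ _

lemma sg1_insert (e f : E) (σ : Finset E) (h : f ∉ σ) :
    sg1 rk e (insert f σ) = (if rk f < rk e then -1 else 1) * sg1 rk e σ := by
  unfold sg1
  rw [Finset.filter_insert]
  split_ifs with h1
  · rw [Finset.card_insert_of_notMem (by simp [h]), pow_succ]; ring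
  · simp

lemma sg1_insert_self (e : E) (σ : Finset E) : sg1 rk e (insert e σ) = sg1 rk e σ := by
  unfold sg1
  rw [Finset.filter_insert]; simp

variable {rk}

lemma ext_single {M : Type*} [AddCommGroup M] (f g : TT E →ₗ[ℤ] M)
    (h : ∀ σ, f (Finsupp.single σ 1) = g (Finsupp.single σ 1)) : f = g := by
  apply Finsupp.lhom_ext'
  intro σ
  apply LinearMap.ext_ring
  simpa using h σ

lemma WW (hrk : Function.Injective rk) (e f : E) (x : TT E) :
    W rk e (W rk f x) = - W rk f (W rk e x) := by
  suffices h : (W rk e) ∘ₗ (W rk f) = - ((W rk f) ∘ₗ (W rk e)) by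
    exact congrArg (fun F => F x) h
  apply ext_single
  intro σ
  simp only [LinearMap.comp_apply, LinearMap.neg_apply, W_single]
  by_cases hef : e = f
  · subst hef
    by_cases he : e ∈ σ
    · rw [if_pos he, map_zero, neg_zero]
    · rw [if_neg he, map_smul, W_single, if_pos (Finset.mem_insert_self _ _), smul_zero, neg_zero]
  · have hne : rk e ≠ rk f := fun h => hef (hrk h)
    have hfe : f ≠ e := Ne.symm hef
    by_cases he : e ∈ σ
    · by_cases hf : f ∈ σ
      · rw [if_pos he, if_pos hf, map_zero, map_zero, neg_zero]
      · rw [if_pos he, if_neg hf, map_zero, map_smul, W_single,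
          if_pos (Finset.mem_insert_of_mem he), smul_zero, neg_zero]
    · by_cases hf : f ∈ σ
      · rw [if_neg he, if_pos hf, map_zero, map_smul, W_single,
          if_pos (Finset.mem_insert_of_mem hf), smul_zero, neg_zero]
      · rw [if_neg he, if_neg hf, map_smul, map_smul, W_single, W_single,
          if_neg (by simp [hef, he]), if_neg (by simp [hfe, hf]),
          sg1_insert rk e f σ hf, sg1_insert rk f e σ he, Finset.insert_comm e f]
        simp only [Finsupp.smul_single, smul_eq_mul, ← Finsupp.single_neg]
        congr 1
        rcases lt_or_gt_of_ne hne with h | h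
        · rw [if_neg (by omega), if_pos h]; ring
        · rw [if_pos h, if_neg (by omega)]; ring

lemma WWself (e : E) (x : TT E) : W rk e (W rk e x) = 0 := by
  suffices h : (W rk e) ∘ₗ (W rk e) = 0 by exact congrArg (fun F => F x) h
  apply ext_single
  intro σ
  simp only [LinearMap.comp_apply, W_single]
  by_cases he : e ∈ σ
  · rw [if_pos he, map_zero]; rfl
  · rw [if_neg he, map_smul, W_single, if_pos (Finset.mem_insert_self _ _), smul_zero]; rfl

lemma DW (hrk : Function.Injective rk) (φ : E → ℤ) (e : E) (x : TT E) :
    D rk φ (W rk e x) = φ e • x - W rk e (D rk φ x) := by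
  suffices h : (D rk φ) ∘ₗ (W rk e) = φ e • LinearMap.id - (W rk e) ∘ₗ (D rk φ) by
    exact congrArg (fun F => F x) h
  apply ext_single
  intro σ
  simp only [LinearMap.comp_apply, LinearMap.sub_apply, LinearMap.smul_apply, LinearMap.id_apply,
    W_single, D_single, map_sum, map_smul]
  by_cases he : e ∈ σ
  · rw [if_pos he, map_zero, Finset.sum_eq_single e]
    · have : sg1 rk e (σ.erase e) = sg1 rk e σ := by
        conv_rhs => rw [← Finset.insert_erase he, sg1_insert_self]
      simp only [Finset.notMem_erase, if_false, this, Finset.insert_erase he, smul_smul]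
      rw [mul_assoc, sg1_sq]; simp
    · intro v hv hve
      rw [if_pos (by simp [he, Ne.symm hve])]; simp
    · intro h; exact absurd he h
  · rw [if_neg he, map_smul, D_single, Finset.sum_insert he, smul_add, Finset.erase_insert he,
      smul_smul, sg1_insert_self, sub_eq_add_neg, ← Finset.sum_neg_distrib]
    congr 1
    · congr 1
      rw [mul_left_comm, sg1_sq, mul_one]
    · rw [Finset.smul_sum]
      apply Finset.sum_congr rfl
      intro v hv
      have hve : v ≠ e := fun h => he (h ▸ hv)
      have hne : rk v ≠ rk e := fun h => hve (hrk h)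
      rw [if_neg (by simp [he]), sg1_insert rk v e σ he, Finset.erase_insert_of_ne hve.symm]
      have h2 : sg1 rk e σ = (if rk v < rk e then -1 else 1) * sg1 rk e (σ.erase v) := by
        conv_lhs => rw [← Finset.insert_erase hv]
        rw [sg1_insert rk e v _ (by simp)]
      rw [h2]
      simp only [Finsupp.smul_single, smul_eq_mul, ← Finsupp.single_neg]
      congr 1
      rcases lt_or_gt_of_ne hne with h | h
      · rw [if_pos h, if_neg (by omega)]; ring
      · rw [if_neg (by omega), if_pos h]; ring

variable (rk)

/-- The exterior product of a list. -/
def o : List E → TT E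
  | [] => Finsupp.single ∅ 1
  | e :: l => W rk e (o l)

variable {rk}

lemma exists_list (hrk : Function.Injective rk) (σ : Finset E) :
    ∃ l : List E, l.Nodup ∧ l.toFinset = σ ∧ o rk l = Finsupp.single σ 1 := by
  induction' hn : σ.card with n ih generalizing σ
  · rw [Finset.card_eq_zero] at hn
    exact ⟨[], by simp, by simp [hn], by simp [o, hn]⟩
  · have hne : σ.Nonempty := by rw [← Finset.card_pos]; omega
    obtain ⟨e, he, hmin⟩ := Finset.exists_min_image σ rk hne
    obtain ⟨l, h1, h2, h3⟩ := ih (σ.erase e) (by rw [Finset.card_erase_of_mem he]; omega)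
    refine ⟨e :: l, ?_, ?_, ?_⟩
    · rw [List.nodup_cons]; refine ⟨?_, h1⟩
      rw [← List.mem_toFinset, h2]; simp
    · rw [List.toFinset_cons, h2, Finset.insert_erase he]
    · rw [o, h3, W_single, if_neg (by simp), Finset.insert_erase he]
      have : (σ.erase e).filter (fun u => rk u < rk e) = ∅ := by
        rw [Finset.filter_eq_empty_iff]
        intro x hx
        have := hmin x (Finset.mem_of_mem_erase hx)
        omega
      simp [sg1, this]

lemma o_single (l : List E) (h : l.Nodup) :
    ∃ ε : ℤ, (ε = 1 ∨ ε = -1) ∧ o rk l = ε • Finsupp.single l.toFinset 1 := by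
  induction l with
  | nil => exact ⟨1, by simp, by simp [o]⟩
  | cons e l ih =>
    rw [List.nodup_cons] at h
    obtain ⟨ε, h1, h2⟩ := ih h.2
    refine ⟨ε * sg1 rk e l.toFinset, ?_, ?_⟩
    · rcases h1 with h1 | h1 <;> rcases sg1_cases rk e l.toFinset with h3 | h3 <;> simp [h1, h3]
    · rw [o, h2, map_smul, W_single, if_neg (by simpa using h.1), smul_smul, List.toFinset_cons]

/-- Two linear maps agreeing on all products agree. -/
lemma ext_o (hrk : Function.Injective rk) {M : Type*} [AddCommGroup M] (f g : TT E →ₗ[ℤ] M)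
    (h : ∀ l, f (o rk l) = g (o rk l)) : f = g := by
  apply ext_single
  intro σ
  obtain ⟨l, -, -, h3⟩ := exists_list hrk σ
  rw [← h3, h]

lemma DD (hrk : Function.Injective rk) (φ ψ : E → ℤ) (x : TT E) :
    D rk φ (D rk ψ x) = - D rk ψ (D rk φ x) := by
  suffices h : (D rk φ) ∘ₗ (D rk ψ) = - ((D rk ψ) ∘ₗ (D rk φ)) by
    exact congrArg (fun F => F x) h
  apply ext_o hrk
  intro l
  simp only [LinearMap.comp_apply, LinearMap.neg_apply]
  induction l with
  | nil => simp [o, D_single]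
  | cons e l ih =>
    simp only [o, DW hrk, map_sub, map_smul, ih, map_neg]
    abel

lemma ddself (hrk : Function.Injective rk) (x : TT E) : dd rk (dd rk x) = 0 := by
  have h := DD hrk (fun _ => 1) (fun _ => 1) x
  have h2 : (2 : ℤ) • dd rk (dd rk x) = 0 := by
    rw [two_smul]; nth_rewrite 1 [h]; simp
  simpa using h2

/-- Alternating functions on lists. -/
def Alt {M : Type*} [AddCommGroup M] (g : List E → M) : Prop :=
  ∀ pre a b l, g (pre ++ a :: b :: l) = - g (pre ++ b :: a :: l)

lemma alt_perm {M : Type*} [AddCommGroup M] {l l' : List E} (h : l.Perm l') :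
    ∀ g : List E → M, Alt g → ∃ ε : ℤ, (ε = 1 ∨ ε = -1) ∧ g l = ε • g l' := by
  induction h with
  | nil => intro g _; exact ⟨1, by simp, by simp⟩
  | cons a _ ih =>
    intro g hg
    exact ih (fun l => g (a :: l)) fun pre a' b l => hg (a :: pre) a' b l
  | swap a b l => intro g hg; exact ⟨-1, by simp, by simpa using hg [] b a l⟩
  | trans _ _ ih1 ih2 =>
    intro g hg
    obtain ⟨ε, h1, h2⟩ := ih1 g hg
    obtain ⟨ε', h3, h4⟩ := ih2 g hg
    refine ⟨ε * ε', ?_, by rw [h2, h4, smul_smul]⟩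
    rcases h1 with h1 | h1 <;> rcases h3 with h3 | h3 <;> simp [h1, h3]

lemma alt_perm2 {M N : Type*} [AddCommGroup M] [AddCommGroup N] {l l' : List E}
    (h : l.Perm l') (g : List E → M) (g' : List E → N) (hg : Alt g) (hg' : Alt g') :
    ∃ ε : ℤ, (ε = 1 ∨ ε = -1) ∧ g l = ε • g l' ∧ g' l = ε • g' l' := by
  obtain ⟨ε, h1, h2⟩ := alt_perm h (fun l => (g l, g' l)) (by
    intro pre a b l; simp [hg pre a b l, hg' pre a b l])
  exact ⟨ε, h1, by simpa using congrArg Prod.fst h2, by simpa using congrArg Prod.snd h2⟩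

lemma o_append_congr (pre : List E) (l l' : List E) (c : ℤ) (h : o rk l = c • o rk l') :
    o rk (pre ++ l) = c • o rk (pre ++ l') := by
  induction pre with
  | nil => simpa using h
  | cons a pre ih => simp [o, ih]

lemma o_alt (hrk : Function.Injective rk) : Alt (o rk) := by
  intro pre a b l
  have := o_append_congr (rk := rk) pre (a :: b :: l) (b :: a :: l) (-1)
    (by simp only [o, neg_smul, one_smul]; exact WW hrk _ _ _)
  simpa using this

/-- The linear map determined by an alternating function on lists. -/
def lift (hrk : Function.Injective rk) {M : Type*} [AddCommGroup M] (g : List E → M) :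
    TT E →ₗ[ℤ] M :=
  Finsupp.lsum ℤ fun σ => LinearMap.toSpanSingleton ℤ _ (g (exists_list hrk σ).choose)

lemma lift_o (hrk : Function.Injective rk) {M : Type*} [AddCommGroup M] (g : List E → M)
    (hg : Alt g) (l : List E) (hl : l.Nodup) : lift hrk g (o rk l) = g l := by
  obtain ⟨h1, h2, h3⟩ := (exists_list hrk l.toFinset).choose_spec
  set l' := (exists_list hrk l.toFinset).choose with hl'
  have hp : l.Perm l' := by
    rw [List.perm_ext_iff_of_nodup hl h1]
    intro a; rw [← List.mem_toFinset, ← List.mem_toFinset, h2]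
  obtain ⟨ε, -, h5, h6⟩ := alt_perm2 hp (o rk) g (o_alt hrk) hg
  rw [h5, h6, map_smul, h3]
  congr 1
  simp [lift, ← hl']

lemma alt_dup {M : Type*} [AddCommGroup M] (g : List E → M) (hg : Alt g)
    (h2 : ∀ x : M, x = -x → x = 0) (l : List E) (hl : ¬ l.Nodup) : g l = 0 := by
  obtain ⟨a, ha⟩ : ∃ a, List.Sublist [a, a] l := by
    by_contra hcon
    push Not at hcon
    exact hl (List.nodup_iff_sublist.2 hcon)
  obtain ⟨m, hm⟩ : ∃ m, l.Perm (a :: a :: m) := by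
    obtain ⟨m, hm⟩ := ha.exists_perm_append
    exact ⟨m, by simpa using hm⟩
  obtain ⟨ε, -, h⟩ := alt_perm hm g hg
  rw [h, h2 (g (a :: a :: m)) (by simpa using hg [] a a m), smul_zero]

end Ext
end
end M14

/-! ### Functoriality and the matching complexes on subsets of the vertices -/

namespace M14

open MatchPaper

noncomputable section

section Fun

variable {E : Type*} [DecidableEq E] {rk : E → ℕ} (hrk : Function.Injective rk)

lemma tt_half (x : TT E) (h : x = -x) : x = 0 := by
  have h2 : (2 : ℤ) • x = 0 := by rw [two_smul]; nth_rewrite 1 [h]; simp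
  simpa using h2

/-- The algebra map induced by a map of vertices. -/
def Tf (f : E → E) : TT E →ₗ[ℤ] TT E := lift hrk fun l => o rk (l.map f)

lemma map_alt (hrk : Function.Injective rk) (f : E → E) : Alt fun l : List E => o rk (l.map f) := by
  intro pre a b l
  simpa using o_alt hrk (pre.map f) (f a) (f b) (l.map f)

lemma o_dup (hrk : Function.Injective rk) (l : List E) (h : ¬ l.Nodup) : o rk l = 0 :=
  alt_dup _ (o_alt hrk) tt_half l h

lemma Tf_o (f : E → E) (l : List E) : Tf hrk f (o rk l) = o rk (l.map f) := by
  by_cases h : l.Nodup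
  · exact lift_o hrk _ (map_alt hrk f) l h
  · rw [o_dup hrk l h, map_zero, o_dup hrk]
    exact fun h2 => h h2.of_map

lemma Tf_W (f : E → E) (e : E) (x : TT E) :
    Tf hrk f (W rk e x) = W rk (f e) (Tf hrk f x) := by
  suffices h : (Tf hrk f) ∘ₗ (W rk e) = (W rk (f e)) ∘ₗ (Tf hrk f) by
    exact congrArg (fun F => F x) h
  apply ext_o hrk
  intro l
  have := Tf_o hrk f (e :: l)
  simp only [o, List.map_cons] at this
  simp only [LinearMap.comp_apply, this, Tf_o]

lemma Tf_dd (f : E → E) (x : TT E) : Tf hrk f (dd rk x) = dd rk (Tf hrk f x) := by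
  suffices h : (Tf hrk f) ∘ₗ (dd rk) = (dd rk) ∘ₗ (Tf hrk f) by
    exact congrArg (fun F => F x) h
  apply ext_o hrk
  intro l
  simp only [LinearMap.comp_apply]
  induction l with
  | nil => rw [Tf_o]; simp [o, D_single]
  | cons e l ih =>
    simp only [o, DW hrk, map_sub, map_smul, Tf_W, ih]

lemma Tf_comp (f g : E → E) (x : TT E) :
    Tf hrk f (Tf hrk g x) = Tf hrk (f ∘ g) x := by
  suffices h : (Tf hrk f) ∘ₗ (Tf hrk g) = Tf hrk (f ∘ g) by
    exact congrArg (fun F => F x) h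
  apply ext_o hrk
  intro l
  simp [LinearMap.comp_apply, Tf_o]

lemma Tf_fix (f : E → E) (σ : Finset E) (h : ∀ p ∈ σ, f p = p) :
    Tf hrk f (Finsupp.single σ 1) = Finsupp.single σ 1 := by
  obtain ⟨l, -, h2, h3⟩ := exists_list hrk σ
  rw [← h3, Tf_o]
  congr 1
  conv_rhs => rw [← List.map_id l]
  apply List.map_congr_left
  intro p hp
  exact h p (by rw [← h2]; simpa using hp)

lemma Tf_single (f : E → E) (σ : Finset E) :
    Tf hrk f (Finsupp.single σ 1) = 0 ∨ (σ.image f).card = σ.card ∧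
      ∃ ε : ℤ, Tf hrk f (Finsupp.single σ 1) = ε • Finsupp.single (σ.image f) 1 := by
  obtain ⟨l, h1, h2, h3⟩ := exists_list hrk σ
  rw [← h3, Tf_o]
  by_cases h : (l.map f).Nodup
  · right
    have him : (l.map f).toFinset = σ.image f := by
      ext p; simp [← h2]
    obtain ⟨ε, -, h5⟩ := o_single (rk := rk) _ h
    refine ⟨?_, ε, by rw [h5, him]⟩
    rw [← him, List.toFinset_card_of_nodup h, ← h2, List.toFinset_card_of_nodup h1, List.length_map]
  · left; exact o_dup hrk _ h

/-- Contraction with one element. -/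
abbrev th (rk : E → ℕ) (e : E) : TT E →ₗ[ℤ] TT E := D rk fun p => if p = e then 1 else 0

lemma th_single (e : E) (σ : Finset E) : th rk e (Finsupp.single σ 1) =
    if e ∈ σ then sg1 rk e σ • Finsupp.single (σ.erase e) 1 else 0 := by
  rw [D_single]
  by_cases h : e ∈ σ
  · rw [if_pos h, Finset.sum_eq_single e]
    · simp
    · intro b _ hb; simp [hb]
    · intro h2; exact absurd h h2
  · rw [if_neg h]
    apply Finset.sum_eq_zero
    intro v hv
    have : v ≠ e := fun h2 => h (h2 ▸ hv)
    simp [this]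

lemma W_th (e : E) (σ : Finset E) : W rk e (th rk e (Finsupp.single σ 1)) =
    if e ∈ σ then Finsupp.single σ 1 else 0 := by
  rw [th_single]
  by_cases h : e ∈ σ
  · have : sg1 rk e (σ.erase e) = sg1 rk e σ := by
      conv_rhs => rw [← Finset.insert_erase h, sg1_insert_self]
    rw [if_pos h, if_pos h, map_smul, W_single, if_neg (by simp), smul_smul, this, sg1_sq,
      Finset.insert_erase h, one_smul]
  · rw [if_neg h, if_neg h, map_zero]

end Fun

section Mat

variable {n : ℕ}

/-- The rank function is injective. -/
lemma rankP_inj (n : ℕ) : Function.Injective (rankP n) := by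
  rintro ⟨a, b⟩ ⟨c, d⟩ h
  simp only [rankP] at h
  have hb := b.2
  have hd := d.2
  have h1 : a.val = c.val := by
    rcases lt_trichotomy a.val c.val with h2 | h2 | h2
    · have := Nat.mul_le_mul_right n (show a.val + 1 ≤ c.val from h2)
      rw [Nat.add_mul] at this; omega
    · exact h2
    · have := Nat.mul_le_mul_right n (show c.val + 1 ≤ a.val from h2)
      rw [Nat.add_mul] at this; omega
  rw [h1] at h
  have h2 : b.val = d.val := by omega
  exact Prod.ext (Fin.ext h1) (Fin.ext h2)

/-- The edge between two vertices. -/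
def mk (a b : Fin n) : Fin n × Fin n := (min a b, max a b)

/-- Incidence. -/
def inc (w : Fin n) (p : Fin n × Fin n) : Prop := w = p.1 ∨ w = p.2

lemma inc_mk (w a b : Fin n) : inc w (mk a b) ↔ w = a ∨ w = b := by
  unfold inc mk
  rcases le_total a b with h | h
  · simp [h]
  · simp [h]; tauto

lemma mk_comm (a b : Fin n) : mk a b = mk b a := by
  unfold mk; rw [min_comm, max_comm]

lemma mk_lt (a b : Fin n) (h : a ≠ b) : (mk a b).1 < (mk a b).2 := by
  unfold mk; simpa using h.symm

lemma eq_mk (p : Fin n × Fin n) (hp : p.1 < p.2) (a b : Fin n) (hab : a ≠ b) (ha : inc a p)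
    (hb : inc b p) : p = mk a b := by
  obtain ⟨x, y⟩ := p
  simp only [inc] at *
  rcases ha with rfl | rfl <;> rcases hb with rfl | rfl
  · exact absurd rfl hab
  · simp [mk, hp.le]
  · simp [mk, hp.le]
  · exact absurd rfl hab

lemma emap_mk (g : Equiv.Perm (Fin n)) (a b : Fin n) : emap g (mk a b) = mk (g a) (g b) := by
  unfold emap mk
  rcases le_total a b with h | h
  · simp [h]
  · simp [h, min_comm, max_comm]

lemma emap_comp (g h : Equiv.Perm (Fin n)) : emap g ∘ emap h = emap (g * h) := by
  funext p
  have : emap h p = mk (h p.1) (h p.2) := rfl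
  simp only [Function.comp, this, emap_mk]
  rfl

lemma match_iff (σ : Finset (Fin n × Fin n)) : IsMatching n σ ↔
    (∀ p ∈ σ, p.1 < p.2) ∧ ∀ p ∈ σ, ∀ q ∈ σ, ∀ w, inc w p → inc w q → p = q := by
  unfold IsMatching
  refine and_congr_right fun _ => ⟨?_, ?_⟩
  · intro h p hp q hq w h1 h2
    by_contra hne
    obtain ⟨a1, a2, a3, a4⟩ := h p hp q hq hne
    rcases h1 with rfl | rfl <;> rcases h2 with h2 | h2 <;> contradiction
  · intro h p hp q hq hne
    refine ⟨fun h1 => ?_, fun h1 => ?_, fun h1 => ?_, fun h1 => ?_⟩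
    · exact hne (h p hp q hq p.1 (Or.inl rfl) (Or.inl h1))
    · exact hne (h p hp q hq p.1 (Or.inl rfl) (Or.inr h1))
    · exact hne (h p hp q hq p.2 (Or.inr rfl) (Or.inl h1))
    · exact hne (h p hp q hq p.2 (Or.inr rfl) (Or.inr h1))

/-- Matchings with `r` edges inside `A`. -/
def Mt (A : Finset (Fin n)) (r : ℕ) (σ : Finset (Fin n × Fin n)) : Prop :=
  ((∀ p ∈ σ, p.1 < p.2) ∧ ∀ p ∈ σ, ∀ q ∈ σ, ∀ w, inc w p → inc w q → p = q) ∧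
    σ.card = r ∧ ∀ p ∈ σ, ∀ w, inc w p → w ∈ A

/-- Chains on matchings with `r` edges inside `A`. -/
def C (A : Finset (Fin n)) (r : ℕ) : Submodule ℤ (TT (Fin n × Fin n)) :=
  Submodule.span ℤ ((fun σ => Finsupp.single σ 1) '' {σ | Mt A r σ})

lemma single_mem {A : Finset (Fin n)} {r : ℕ} {σ : Finset (Fin n × Fin n)} (h : Mt A r σ) :
    Finsupp.single σ 1 ∈ C A r := Submodule.subset_span ⟨σ, h, rfl⟩

lemma C_map {A : Finset (Fin n)} {r : ℕ} {M : Type*} [AddCommGroup M]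
    (F : TT (Fin n × Fin n) →ₗ[ℤ] M) (S : Submodule ℤ M)
    (h : ∀ σ, Mt A r σ → F (Finsupp.single σ 1) ∈ S) {x} (hx : x ∈ C A r) : F x ∈ S := by
  have : C A r ≤ S.comap F := by
    unfold C
    rw [Submodule.span_le]
    rintro _ ⟨σ, hσ, rfl⟩
    exact h σ hσ
  exact this hx

lemma C_eq {A : Finset (Fin n)} {r : ℕ} {M : Type*} [AddCommGroup M]
    (F G : TT (Fin n × Fin n) →ₗ[ℤ] M)
    (h : ∀ σ, Mt A r σ → F (Finsupp.single σ 1) = G (Finsupp.single σ 1)) {x} (hx : x ∈ C A r) :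
    F x = G x := by
  have := C_map (F - G) ⊥ (fun σ hσ => by simp [h σ hσ]) hx
  rw [Submodule.mem_bot, LinearMap.sub_apply, sub_eq_zero] at this
  exact this

lemma Mt_mono {A A' : Finset (Fin n)} (h : A ⊆ A') {r σ} (hσ : Mt A r σ) : Mt A' r σ :=
  ⟨hσ.1, hσ.2.1, fun p hp w hw => h (hσ.2.2 p hp w hw)⟩

lemma C_mono {A A' : Finset (Fin n)} (h : A ⊆ A') {r : ℕ} : C A r ≤ C A' r :=
  Submodule.span_mono (Set.image_mono fun _ hσ => Mt_mono h hσ)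

lemma Mt_erase {A : Finset (Fin n)} {r σ} (hσ : Mt A (r + 1) σ) (e) (he : e ∈ σ) :
    Mt A r (σ.erase e) := by
  refine ⟨⟨fun p hp => hσ.1.1 p (Finset.mem_of_mem_erase hp), fun p hp q hq =>
    hσ.1.2 p (Finset.mem_of_mem_erase hp) q (Finset.mem_of_mem_erase hq)⟩, ?_,
    fun p hp => hσ.2.2 p (Finset.mem_of_mem_erase hp)⟩
  rw [Finset.card_erase_of_mem he, hσ.2.1]; rfl

lemma Mt_insert {A : Finset (Fin n)} {r τ} (h : Mt A r τ) (a b : Fin n) (hab : a ≠ b)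
    (ha : a ∈ A) (hb : b ∈ A) (h2 : ∀ p ∈ τ, ¬ inc a p ∧ ¬ inc b p) :
    mk a b ∉ τ ∧ Mt A (r + 1) (insert (mk a b) τ) := by
  have h0 : mk a b ∉ τ := fun h3 => (h2 _ h3).1 ((inc_mk _ _ _).2 (Or.inl rfl))
  refine ⟨h0, ⟨?_, ?_⟩, ?_, ?_⟩
  · intro p hp
    rcases Finset.mem_insert.1 hp with rfl | hp
    · exact mk_lt a b hab
    · exact h.1.1 p hp
  · intro p hp q hq w hw1 hw2
    rcases Finset.mem_insert.1 hp with rfl | hp' <;> rcases Finset.mem_insert.1 hq with rfl | hq'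
    · rfl
    · rcases (inc_mk _ _ _).1 hw1 with rfl | rfl
      · exact absurd hw2 (h2 q hq').1
      · exact absurd hw2 (h2 q hq').2
    · rcases (inc_mk _ _ _).1 hw2 with rfl | rfl
      · exact absurd hw1 (h2 p hp').1
      · exact absurd hw1 (h2 p hp').2
    · exact h.1.2 p hp' q hq' w hw1 hw2
  · rw [Finset.card_insert_of_notMem h0, h.2.1]
  · intro p hp w hw
    rcases Finset.mem_insert.1 hp with rfl | hp
    · rcases (inc_mk _ _ _).1 hw with rfl | rfl <;> assumption
    · exact h.2.2 p hp w hw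

lemma D_mem {A : Finset (Fin n)} {r : ℕ} (φ : Fin n × Fin n → ℤ) {x} (hx : x ∈ C A (r + 1)) :
    D (rankP n) φ x ∈ C A r := by
  refine C_map _ _ (fun σ hσ => ?_) hx
  rw [D_single]
  exact Submodule.sum_mem _ fun v hv => Submodule.smul_mem _ _ (single_mem (Mt_erase hσ v hv))

lemma W_mem {A A' : Finset (Fin n)} (h : A' ⊆ A) {r : ℕ} (a b : Fin n) (hab : a ≠ b) (ha : a ∈ A)
    (hb : b ∈ A) (ha' : a ∉ A') (hb' : b ∉ A') {x} (hx : x ∈ C A' r) :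
    W (rankP n) (mk a b) x ∈ C A (r + 1) := by
  refine C_map _ _ (fun σ hσ => ?_) hx
  obtain ⟨h1, h2⟩ := Mt_insert (Mt_mono h hσ) a b hab ha hb fun p hp =>
    ⟨fun h3 => ha' (hσ.2.2 p hp _ h3), fun h3 => hb' (hσ.2.2 p hp _ h3)⟩
  rw [W_single, if_neg h1]
  exact Submodule.smul_mem _ _ (single_mem h2)

lemma th_mem {A : Finset (Fin n)} {r : ℕ} (a b : Fin n) {x} (hx : x ∈ C A (r + 1)) :
    th (rankP n) (mk a b) x ∈ C ((A.erase a).erase b) r := by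
  refine C_map _ _ (fun σ hσ => ?_) hx
  rw [th_single]
  split_ifs with h
  · refine Submodule.smul_mem _ _ (single_mem ?_)
    refine ⟨(Mt_erase hσ _ h).1, (Mt_erase hσ _ h).2.1, fun p hp w hw => ?_⟩
    have h1 := hσ.2.2 p (Finset.mem_of_mem_erase hp) w hw
    have h2 : p ≠ mk a b := Finset.ne_of_mem_erase hp
    have h3 := hσ.1.2 p (Finset.mem_of_mem_erase hp) _ h w hw
    rw [inc_mk] at h3
    simp only [Finset.mem_erase]
    tauto
  · exact Submodule.zero_mem _

/-- The action of a permutation of the vertices. -/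
abbrev Tg (g : Equiv.Perm (Fin n)) : TT (Fin n × Fin n) →ₗ[ℤ] TT (Fin n × Fin n) :=
  Tf (rankP_inj n) (emap g)

lemma inc_emap (g : Equiv.Perm (Fin n)) (p : Fin n × Fin n) (w : Fin n) :
    inc w (emap g p) ↔ inc (g.symm w) p := by
  have : emap g p = mk (g p.1) (g p.2) := rfl
  rw [this, inc_mk]
  unfold inc
  rw [Equiv.symm_apply_eq, Equiv.symm_apply_eq]

lemma Tg_mem {A : Finset (Fin n)} {r : ℕ} (g : Equiv.Perm (Fin n)) (hg : ∀ a ∈ A, g a ∈ A) {x}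
    (hx : x ∈ C A r) : Tg g x ∈ C A r := by
  refine C_map _ _ (fun σ hσ => ?_) hx
  rcases Tf_single (rankP_inj n) (emap g) σ with h | ⟨h, ε, h2⟩
  · rw [h]; exact Submodule.zero_mem _
  · rw [h2]
    refine Submodule.smul_mem _ _ (single_mem ⟨⟨?_, ?_⟩, by rw [h, hσ.2.1], ?_⟩)
    · intro p hp
      obtain ⟨q, hq, rfl⟩ := Finset.mem_image.1 hp
      exact mk_lt _ _ fun h => (hσ.1.1 q hq).ne (g.injective h)
    · intro p hp q hq w hw1 hw2
      obtain ⟨p, hp', rfl⟩ := Finset.mem_image.1 hp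
      obtain ⟨q, hq', rfl⟩ := Finset.mem_image.1 hq
      rw [inc_emap] at hw1 hw2
      rw [hσ.1.2 p hp' q hq' _ hw1 hw2]
    · intro p hp w hw
      obtain ⟨p, hp', rfl⟩ := Finset.mem_image.1 hp
      rw [inc_emap] at hw
      simpa using hg _ (hσ.2.2 p hp' _ hw)

lemma Tg_one {A : Finset (Fin n)} {r : ℕ} {x} (hx : x ∈ C A r) : Tg 1 x = x := by
  refine C_eq (Tg 1) LinearMap.id (fun σ hσ => ?_) hx
  rw [LinearMap.id_apply]
  apply Tf_fix
  intro p hp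
  have := hσ.1.1 p hp
  simp [emap, this.le]

lemma Tg_mul (g h : Equiv.Perm (Fin n)) (x) : Tg g (Tg h x) = Tg (g * h) x := by
  unfold Tg
  rw [Tf_comp, emap_comp]

lemma Tg_fix (a v : Fin n) (σ : Finset (Fin n × Fin n)) (h0 : ∀ p ∈ σ, p.1 < p.2)
    (h : ∀ p ∈ σ, ¬ inc a p ∧ ¬ inc v p) :
    Tg (Equiv.swap a v) (Finsupp.single σ 1) = Finsupp.single σ 1 := by
  apply Tf_fix
  intro p hp
  obtain ⟨h1, h2⟩ := h p hp
  unfold inc at h1 h2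
  push Not at h1 h2
  have := h0 p hp
  unfold emap
  rw [Equiv.swap_apply_of_ne_of_ne h1.1.symm h2.1.symm,
    Equiv.swap_apply_of_ne_of_ne h1.2.symm h2.2.symm]
  simp [this.le]

open Classical in
/-- Projection to the matchings. -/
def mu (n : ℕ) : TT (Fin n × Fin n) →ₗ[ℤ] TT (Fin n × Fin n) :=
  Finsupp.lsum ℤ fun σ => LinearMap.toSpanSingleton ℤ _
    (if IsMatching n σ then Finsupp.single σ (1 : ℤ) else 0)

lemma mu_pos (σ : Finset (Fin n × Fin n)) (h : IsMatching n σ) :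
    mu n (Finsupp.single σ 1) = Finsupp.single σ 1 := by
  simp [mu, h]

lemma mu_neg (σ : Finset (Fin n × Fin n)) (h : ¬ IsMatching n σ) :
    mu n (Finsupp.single σ 1) = 0 := by
  simp [mu, h]

lemma mu_C {A : Finset (Fin n)} {r : ℕ} {x} (hx : x ∈ C A r) : mu n x = x := by
  refine C_eq (mu n) LinearMap.id (fun σ hσ => ?_) hx
  rw [mu_pos σ ((match_iff σ).2 hσ.1)]; rfl

lemma mu_W_mem {A : Finset (Fin n)} {r : ℕ} (a b : Fin n) (ha : a ∈ A) (hb : b ∈ A) {x}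
    (hx : x ∈ C A r) : mu n (W (rankP n) (mk a b) x) ∈ C A (r + 1) := by
  refine C_map (mu n ∘ₗ W (rankP n) (mk a b)) _ (fun σ hσ => ?_) hx
  rw [LinearMap.comp_apply, W_single]
  split_ifs with h
  · simp
  · rw [map_smul]
    apply Submodule.smul_mem
    by_cases h2 : IsMatching n (insert (mk a b) σ)
    · rw [mu_pos _ h2]
      refine single_mem ⟨(match_iff _).1 h2, by rw [Finset.card_insert_of_notMem h, hσ.2.1], ?_⟩
      intro p hp w hw
      rcases Finset.mem_insert.1 hp with rfl | hp
      · rcases (inc_mk _ _ _).1 hw with rfl | rfl <;> assumption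
      · exact hσ.2.2 p hp w hw
    · rw [mu_neg _ h2]; exact Submodule.zero_mem _

lemma mu_WW (a b c : Fin n) (hbc : b ≠ c) (x) :
    mu n (W (rankP n) (mk a b) (W (rankP n) (mk a c) x)) = 0 := by
  have hne : mk a b ≠ mk a c := by
    intro h
    have h1 : inc b (mk a c) := by rw [← h, inc_mk]; exact Or.inr rfl
    have h2 : inc c (mk a b) := by rw [h, inc_mk]; exact Or.inr rfl
    rw [inc_mk] at h1 h2
    rcases h1 with h1 | h1
    · rcases h2 with h2 | h2
      · exact hbc (h1.trans h2.symm)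
      · exact hbc h2.symm
    · exact hbc h1
  suffices h : (mu n) ∘ₗ (W (rankP n) (mk a b)) ∘ₗ (W (rankP n) (mk a c)) = 0 by
    exact congrArg (fun F => F x) h
  apply ext_single
  intro σ
  simp only [LinearMap.comp_apply, W_single, LinearMap.zero_apply]
  by_cases h : mk a c ∈ σ
  · rw [if_pos h, map_zero, map_zero]
  · rw [if_neg h, map_smul, W_single]
    by_cases h2 : mk a b ∈ insert (mk a c) σ
    · rw [if_pos h2, smul_zero, map_zero]
    · rw [if_neg h2, map_smul, map_smul, mu_neg, smul_zero, smul_zero]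
      rw [match_iff]
      intro h3
      exact hne (h3.2 (mk a b) (by simp) (mk a c) (by simp) a (by simp [inc_mk]) (by simp [inc_mk]))

end Mat
end
end M14

/-! ### Torsion: the groups in degree `r`, on `2 r + 4` vertices, have finite exponent -/

namespace M14

open MatchPaper

noncomputable section

variable {n : ℕ}

/-- Boundaries. -/
def Bd (A : Finset (Fin n)) (r : ℕ) : Submodule ℤ (TT (Fin n × Fin n)) :=
  (C A (r + 1)).map (dd (rankP n))

lemma dd_mem_Bd {A : Finset (Fin n)} {r : ℕ} {w} (hw : w ∈ C A (r + 1)) :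
    dd (rankP n) w ∈ Bd A r := ⟨w, hw, rfl⟩

lemma Bd_zero (A : Finset (Fin n)) (hA : 2 ≤ A.card) {z} (hz : z ∈ C A 0) : z ∈ Bd A 0 := by
  obtain ⟨a, ha, b, hb, hab⟩ := Finset.one_lt_card.1 (show 1 < A.card by omega)
  refine C_map LinearMap.id _ (fun σ hσ => ?_) hz
  obtain rfl : σ = ∅ := Finset.card_eq_zero.1 hσ.2.1
  have h := Mt_insert hσ a b hab ha hb (by simp)
  refine ⟨W (rankP n) (mk a b) (Finsupp.single ∅ 1), ?_, ?_⟩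
  · rw [W_single, if_neg h.1]
    exact Submodule.smul_mem _ _ (single_mem h.2)
  · rw [DW (rankP_inj n), D_single]
    simp

/-- The part of a chain touching `v` can be split off. -/
lemma split_mem {A : Finset (Fin n)} {r : ℕ} (v : Fin n) {z} (hz : z ∈ C A (r + 1)) :
    z - ∑ x ∈ A.erase v, W (rankP n) (mk x v) (th (rankP n) (mk x v) z) ∈ C (A.erase v) (r + 1) := by
  have := C_map (A := A) (r := r + 1) (LinearMap.id -
    ∑ x ∈ A.erase v, W (rankP n) (mk x v) ∘ₗ th (rankP n) (mk x v)) (C (A.erase v) (r + 1)) ?_ hz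
  · simpa using this
  intro σ hσ
  simp only [LinearMap.sub_apply, LinearMap.id_apply, LinearMap.sum_apply, LinearMap.comp_apply,
    W_th]
  by_cases h : ∃ p ∈ σ, inc v p
  · obtain ⟨p, hp, hv⟩ := h
    have hlt := hσ.1.1 p hp
    obtain ⟨x, hxv, hx⟩ : ∃ x, x ≠ v ∧ inc x p := by
      rcases hv with h | h
      · exact ⟨p.2, fun h2 => by rw [h2, h] at hlt; exact lt_irrefl _ hlt, Or.inr rfl⟩
      · exact ⟨p.1, fun h2 => by rw [h2, h] at hlt; exact lt_irrefl _ hlt, Or.inl rfl⟩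
    have hpe := eq_mk p hlt x v hxv hx hv
    rw [Finset.sum_eq_single x]
    · rw [← hpe, if_pos hp, sub_self]; exact Submodule.zero_mem _
    · intro y hy hyx
      rw [if_neg]
      intro h
      have h2 := hσ.1.2 _ h p hp v ((inc_mk _ _ _).2 (Or.inr rfl)) hv
      have h3 : inc y p := by rw [← h2, inc_mk]; exact Or.inl rfl
      rw [hpe, inc_mk] at h3
      rcases h3 with h3 | h3
      · exact hyx h3
      · exact Finset.ne_of_mem_erase hy h3
    · intro h
      exact absurd (Finset.mem_erase.2 ⟨hxv, hσ.2.2 p hp x hx⟩) h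
  · push Not at h
    rw [Finset.sum_eq_zero, sub_zero]
    · refine single_mem ⟨hσ.1, hσ.2.1, fun p hp w hw => Finset.mem_erase.2 ⟨?_, hσ.2.2 p hp w hw⟩⟩
      rintro rfl
      exact h p hp hw
    · intro x _
      rw [if_neg]
      intro h2
      exact h _ h2 ((inc_mk _ _ _).2 (Or.inr rfl))

/-- Pushing a cycle off the vertex `v`. -/
lemma claim1 {A : Finset (Fin n)} {r : ℕ} {N : ℤ}
    (hN : ∀ A' : Finset (Fin n), A'.card + 2 = A.card → ∀ z ∈ C A' r, dd (rankP n) z = 0 →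
      N • z ∈ Bd A' r)
    {v : Fin n} (hv : v ∈ A) {z} (hz : z ∈ C A (r + 1)) (hc : dd (rankP n) z = 0) :
    ∃ z0 ∈ C (A.erase v) (r + 1), ∃ y ∈ C A (r + 2), dd (rankP n) z0 = 0 ∧
      N • z = z0 + dd (rankP n) y := by
  have h1 : ∀ x, ∃ w, x ∈ A.erase v → w ∈ C ((A.erase x).erase v) (r + 1) ∧
      dd (rankP n) w = N • th (rankP n) (mk x v) z := by
    intro x
    by_cases hx : x ∈ A.erase v
    · have hxA := Finset.mem_of_mem_erase hx
      have hxv := Finset.ne_of_mem_erase hx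
      obtain ⟨w, hw1, hw2⟩ := hN ((A.erase x).erase v) (by
        have := Finset.one_lt_card.2 ⟨x, hxA, v, hv, hxv⟩
        rw [Finset.card_erase_of_mem (Finset.mem_erase.2 ⟨hxv.symm, hv⟩),
          Finset.card_erase_of_mem hxA]
        omega) _ (th_mem x v hz) (by
          have := DD (rankP_inj n) (fun _ => 1) (fun p => if p = mk x v then 1 else 0) z
          unfold dd at hc ⊢
          unfold th
          rw [this, hc, map_zero, neg_zero])
      exact ⟨w, fun _ => ⟨hw1, hw2⟩⟩
    · exact ⟨0, fun h => absurd h hx⟩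
  choose w hw using h1
  have hz0 : N • (z - ∑ x ∈ A.erase v, W (rankP n) (mk x v) (th (rankP n) (mk x v) z)) +
      ∑ x ∈ A.erase v, w x ∈ C (A.erase v) (r + 1) := by
    refine Submodule.add_mem _ (Submodule.smul_mem _ _ (split_mem v hz))
      (Submodule.sum_mem _ fun x hx => ?_)
    refine C_mono ?_ (hw x hx).1
    exact Finset.erase_subset_erase _ (Finset.erase_subset _ _)
  have hy : -∑ x ∈ A.erase v, W (rankP n) (mk x v) (w x) ∈ C A (r + 2) := by
    refine Submodule.neg_mem _ (Submodule.sum_mem _ fun x hx => ?_)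
    have hxA := Finset.mem_of_mem_erase hx
    have hxv := Finset.ne_of_mem_erase hx
    exact W_mem ((Finset.erase_subset _ _).trans (Finset.erase_subset _ _)) x v hxv hxA hv
      (by simp) (by simp) (hw x hx).1
  have heq : N • z = N • (z - ∑ x ∈ A.erase v, W (rankP n) (mk x v) (th (rankP n) (mk x v) z)) +
      ∑ x ∈ A.erase v, w x +
      dd (rankP n) (-∑ x ∈ A.erase v, W (rankP n) (mk x v) (w x)) := by
    have h2 : dd (rankP n) (∑ x ∈ A.erase v, W (rankP n) (mk x v) (w x)) =
        ∑ x ∈ A.erase v, w x -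
        N • ∑ x ∈ A.erase v, W (rankP n) (mk x v) (th (rankP n) (mk x v) z) := by
      rw [map_sum, Finset.smul_sum, ← Finset.sum_sub_distrib]
      apply Finset.sum_congr rfl
      intro x hx
      have h3 := (hw x hx).2
      unfold dd at h3 ⊢
      rw [DW (rankP_inj n), h3, map_smul, one_smul]
    rw [map_neg, h2, smul_sub]
    abel
  refine ⟨_, hz0, _, hy, ?_, heq⟩
  have h3 := congrArg (dd (rankP n)) heq
  rw [map_add, ddself (rankP_inj n), map_smul, hc, smul_zero, add_zero] at h3
  exact h3.symm

/-- The local computation for the vertex `x`, not covered by `σ`. -/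
lemma local1 {A : Finset (Fin n)} {r : ℕ} {σ : Finset (Fin n × Fin n)} {v x : Fin n}
    (hσ : Mt A r σ) (hxv : x ≠ v)
    (hx : ∀ p ∈ σ, ¬ inc x p) (hv : ∀ p ∈ σ, ¬ inc v p) :
    dd (rankP n) (mu n (W (rankP n) (mk x v) (Finsupp.single σ 1))) +
      mu n (W (rankP n) (mk x v) (dd (rankP n) (Finsupp.single σ 1))) =
    Tg (Equiv.swap x v) (Finsupp.single σ 1) := by
  rw [Tg_fix x v σ hσ.1.1 fun p hp => ⟨hx p hp, hv p hp⟩]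
  have hS : Finsupp.single σ 1 ∈ C ((Finset.univ.erase x).erase v) r := by
    refine single_mem ⟨hσ.1, hσ.2.1, fun p hp w hw => ?_⟩
    simp only [Finset.mem_erase, Finset.mem_univ, and_true]
    exact ⟨fun h => hv p hp (h ▸ hw), fun h => hx p hp (h ▸ hw)⟩
  have hW : ∀ {s : ℕ} {y}, y ∈ C ((Finset.univ.erase x).erase v) s →
      mu n (W (rankP n) (mk x v) y) = W (rankP n) (mk x v) y := fun hy =>
    mu_C (W_mem (Finset.subset_univ _) x v hxv (Finset.mem_univ _) (Finset.mem_univ _)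
      (by simp) (by simp) hy)
  rw [hW hS]
  have h2 : mu n (W (rankP n) (mk x v) (dd (rankP n) (Finsupp.single σ 1))) =
      W (rankP n) (mk x v) (dd (rankP n) (Finsupp.single σ 1)) := by
    rcases r with _ | r
    · obtain rfl : σ = ∅ := Finset.card_eq_zero.1 hσ.2.1
      rw [D_single]; simp
    · exact hW (D_mem _ hS)
  rw [h2]
  unfold dd
  rw [DW (rankP_inj n), one_smul]
  abel

/-- The local computation for the vertex `x`, matched with `y` in `σ`. -/
lemma local2 {A : Finset (Fin n)} {r : ℕ} {σ : Finset (Fin n × Fin n)} {v x y : Fin n}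
    (hσ : Mt A (r + 1) σ) (hxv : x ≠ v) (hxy : x ≠ y) (hyv : y ≠ v)
    (hf : mk x y ∈ σ) (hv : ∀ p ∈ σ, ¬ inc v p) :
    dd (rankP n) (mu n (W (rankP n) (mk x v) (Finsupp.single σ 1))) +
      mu n (W (rankP n) (mk x v) (dd (rankP n) (Finsupp.single σ 1))) =
    Tg (Equiv.swap y v) (Finsupp.single σ 1) := by
  set τ := σ.erase (mk x y) with hτ
  have hτM : Mt A r τ := Mt_erase hσ _ hf
  have hoff : ∀ p ∈ τ, ¬ inc x p ∧ ¬ inc y p := by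
    intro p hp
    have h1 := Finset.mem_of_mem_erase hp
    have h2 := Finset.ne_of_mem_erase hp
    exact ⟨fun h => h2 (hσ.1.2 p h1 _ hf x h ((inc_mk _ _ _).2 (Or.inl rfl))),
      fun h => h2 (hσ.1.2 p h1 _ hf y h ((inc_mk _ _ _).2 (Or.inr rfl)))⟩
  have hvoff : ∀ p ∈ τ, ¬ inc v p := fun p hp => hv p (Finset.mem_of_mem_erase hp)
  have hs : Finsupp.single σ 1 = sg1 (rankP n) (mk x y) σ •
      W (rankP n) (mk x y) (Finsupp.single τ 1) := by
    have := W_th (rk := rankP n) (mk x y) σ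
    rw [th_single, if_pos hf, if_pos hf, map_smul] at this
    exact this.symm
  have hE : mu n (W (rankP n) (mk x v) (Finsupp.single τ 1)) =
      W (rankP n) (mk x v) (Finsupp.single τ 1) := by
    have hS : Finsupp.single τ 1 ∈ C ((Finset.univ.erase x).erase v) r := by
      refine single_mem ⟨hτM.1, hτM.2.1, fun p hp w hw => ?_⟩
      simp only [Finset.mem_erase, Finset.mem_univ, and_true]
      exact ⟨fun h => hvoff p hp (h ▸ hw), fun h => (hoff p hp).1 (h ▸ hw)⟩
    exact mu_C (W_mem (Finset.subset_univ _) x v hxv (Finset.mem_univ _) (Finset.mem_univ _)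
      (by simp) (by simp) hS)
  have hT : Tg (Equiv.swap y v) (Finsupp.single τ 1) = Finsupp.single τ 1 :=
    Tg_fix y v τ hτM.1.1 fun p hp => ⟨(hoff p hp).2, hvoff p hp⟩
  rw [hs]
  simp only [map_smul]
  rw [← smul_add]
  congr 1
  rw [mu_WW x v y hyv.symm, map_zero, zero_add]
  unfold dd Tg at *
  rw [DW (rankP_inj n), one_smul, map_sub, map_sub, mu_WW x v y hyv.symm, sub_zero, hE, Tf_W, hT,
    emap_mk, Equiv.swap_apply_left, Equiv.swap_apply_of_ne_of_ne hxy hxv]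

open Classical in
/-- The partner of `x` in the matching `σ`. -/
def partner (σ : Finset (Fin n × Fin n)) (x : Fin n) : Fin n :=
  if h : ∃ y, x ≠ y ∧ mk x y ∈ σ then h.choose else x

lemma partner_spec (σ : Finset (Fin n × Fin n)) (x : Fin n) :
    (partner σ x = x ∧ ¬ ∃ y, x ≠ y ∧ mk x y ∈ σ) ∨ (x ≠ partner σ x ∧ mk x (partner σ x) ∈ σ) := by
  unfold partner
  split_ifs with h
  · exact Or.inr h.choose_spec
  · exact Or.inl ⟨rfl, h⟩

lemma partner_unique {A r} {σ : Finset (Fin n × Fin n)} (hσ : Mt A r σ) (x y : Fin n) (hxy : x ≠ y)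
    (h : mk x y ∈ σ) : partner σ x = y := by
  rcases partner_spec σ x with ⟨-, h2⟩ | ⟨h1, h2⟩
  · exact absurd ⟨y, hxy, h⟩ h2
  · have h3 := hσ.1.2 _ h _ h2 x ((inc_mk _ _ _).2 (Or.inl rfl)) ((inc_mk _ _ _).2 (Or.inl rfl))
    have h4 : inc (partner σ x) (mk x y) := by rw [h3, inc_mk]; exact Or.inr rfl
    rw [inc_mk] at h4
    rcases h4 with h4 | h4
    · exact absurd h4.symm h1
    · exact h4

lemma partner_invol {A r} {σ : Finset (Fin n × Fin n)} (hσ : Mt A r σ) (x : Fin n) :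
    partner σ (partner σ x) = x := by
  rcases partner_spec σ x with ⟨h1, h2⟩ | ⟨h1, h2⟩
  · rw [h1, h1]
  · exact partner_unique hσ _ _ h1.symm (by rw [mk_comm]; exact h2)

lemma partner_mem {A r} {σ : Finset (Fin n × Fin n)} (hσ : Mt A r σ) (x : Fin n) (hx : x ∈ A) :
    partner σ x ∈ A := by
  rcases partner_spec σ x with ⟨h1, h2⟩ | ⟨h1, h2⟩
  · rwa [h1]
  · exact hσ.2.2 _ h2 _ ((inc_mk _ _ _).2 (Or.inr rfl))

/-- The sum of the transpositions moving `v`. -/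
def XX (A : Finset (Fin n)) (v : Fin n) : TT (Fin n × Fin n) →ₗ[ℤ] TT (Fin n × Fin n) :=
  ∑ x ∈ A.erase v, Tg (Equiv.swap x v)

/-- The homotopy. -/
def HH (A : Finset (Fin n)) (v : Fin n) : TT (Fin n × Fin n) →ₗ[ℤ] TT (Fin n × Fin n) :=
  ∑ x ∈ A.erase v, mu n ∘ₗ W (rankP n) (mk x v)

lemma homotopy {A : Finset (Fin n)} {r : ℕ} {v : Fin n} {z} (hz : z ∈ C (A.erase v) r) :
    XX A v z = dd (rankP n) (HH A v z) + HH A v (dd (rankP n) z) := by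
  refine C_eq (XX A v) (dd (rankP n) ∘ₗ HH A v + HH A v ∘ₗ dd (rankP n)) (fun σ hσ => ?_) hz
  simp only [XX, HH, LinearMap.add_apply, LinearMap.comp_apply, LinearMap.sum_apply, map_sum]
  rw [← Finset.sum_add_distrib]
  have hv : ∀ p ∈ σ, ¬ inc v p := fun p hp h => by
    have := hσ.2.2 p hp v h
    simp at this
  refine Finset.sum_nbij' (partner σ) (partner σ) (fun x hx => partner_mem hσ x hx)
    (fun x hx => partner_mem hσ x hx) (fun x _ => partner_invol hσ x)
    (fun x _ => partner_invol hσ x) fun x hx => ?_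
  have hy := partner_mem hσ x hx
  have hxv := Finset.ne_of_mem_erase hx
  have hyv := Finset.ne_of_mem_erase hy
  rcases partner_spec σ x with ⟨h1, h2⟩ | ⟨h1, h2⟩
  · rw [h1]
    symm
    refine local1 hσ hxv (fun p hp hxp => h2 ?_) hv
    have hlt := hσ.1.1 p hp
    obtain ⟨y, hyx, hy⟩ : ∃ y, x ≠ y ∧ inc y p := by
      rcases hxp with h | h
      · exact ⟨p.2, fun h2 => by rw [← h2, h] at hlt; exact lt_irrefl _ hlt, Or.inr rfl⟩
      · exact ⟨p.1, fun h2 => by rw [← h2, h] at hlt; exact lt_irrefl _ hlt, Or.inl rfl⟩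
    exact ⟨y, hyx, eq_mk p hlt x y hyx hxp hy ▸ hp⟩
  · rcases r with _ | r
    · obtain rfl : σ = ∅ := Finset.card_eq_zero.1 hσ.2.1
      simp at h2
    · symm
      exact local2 hσ hyv h1.symm hxv (by rw [mk_comm]; exact h2) hv

lemma Tg_dd (g : Equiv.Perm (Fin n)) (x) : Tg g (dd (rankP n) x) = dd (rankP n) (Tg g x) :=
  Tf_dd _ _ _

lemma swap_mem {A : Finset (Fin n)} {a b : Fin n} (ha : a ∈ A) (hb : b ∈ A) (x) (hx : x ∈ A) :
    Equiv.swap a b x ∈ A := by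
  rw [Equiv.swap_apply_def]; split_ifs <;> assumption

lemma XX_mem {A : Finset (Fin n)} {r : ℕ} {v : Fin n} (hv : v ∈ A) {z} (hz : z ∈ C A r) :
    XX A v z ∈ C A r := by
  rw [XX, LinearMap.sum_apply]
  exact Submodule.sum_mem _ fun x hx => Tg_mem _ (swap_mem (Finset.mem_of_mem_erase hx) hv) hz

lemma XX_dd (A : Finset (Fin n)) (v : Fin n) (z) :
    XX A v (dd (rankP n) z) = dd (rankP n) (XX A v z) := by
  simp only [XX, LinearMap.sum_apply, map_sum, Tg_dd]

lemma claim2 {A : Finset (Fin n)} {r : ℕ} {N : ℤ}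
    (hN : ∀ A' : Finset (Fin n), A'.card + 2 = A.card → ∀ z ∈ C A' r, dd (rankP n) z = 0 →
      N • z ∈ Bd A' r)
    {v : Fin n} (hv : v ∈ A) {z} (hz : z ∈ C A (r + 1)) (hc : dd (rankP n) z = 0) :
    N • XX A v z ∈ Bd A (r + 1) := by
  obtain ⟨z0, h0, y, hy, hc0, h⟩ := claim1 hN hv hz hc
  rw [← map_smul, h, map_add, homotopy h0, hc0, map_zero, add_zero, XX_dd]
  refine Submodule.add_mem _ (dd_mem_Bd ?_) (dd_mem_Bd (XX_mem hv hy))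
  rw [HH, LinearMap.sum_apply]
  exact Submodule.sum_mem _ fun x hx => mu_W_mem x v (Finset.mem_of_mem_erase hx) hv
    (C_mono (Finset.erase_subset _ _) h0)

lemma sum_inv {A S : Finset (Fin n)} {r : ℕ} (hS : S ⊆ A) {v : Fin n} (hv : v ∉ S) {z}
    (hz : z ∈ C A r)
    (hinv : ∀ a ∈ S, ∀ b ∈ S, Tg (Equiv.swap a b) z = z) :
    ∀ a ∈ insert v S, ∀ b ∈ insert v S,
      Tg (Equiv.swap a b) (∑ i ∈ insert v S, Tg (Equiv.swap i v) z) =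
        ∑ i ∈ insert v S, Tg (Equiv.swap i v) z := by
  have key : ∀ a ∈ insert v S, ∀ b ∈ insert v S, a ≠ v → ∀ i ∈ insert v S,
      Tg (Equiv.swap a b) (Tg (Equiv.swap i v) z) = Tg (Equiv.swap (Equiv.swap a b i) v) z := by
    intro a ha b hb hav i hi
    have haS : a ∈ S := (Finset.mem_insert.1 ha).resolve_left hav
    by_cases hbv : b = v
    · subst hbv
      by_cases hib : i = b
      · subst hib
        rw [Equiv.swap_self, Equiv.swap_apply_right]
        have : Tg (Equiv.refl (Fin n)) z = z := Tg_one hz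
        rw [this]
      · have hiS : i ∈ S := (Finset.mem_insert.1 hi).resolve_left hib
        by_cases hia : i = a
        · subst hia
          rw [Tg_mul, Equiv.swap_mul_self, Equiv.swap_apply_left, Equiv.swap_self]
          rfl
        · rw [Equiv.swap_apply_of_ne_of_ne hia hib]
          conv_rhs => rw [← hinv a haS i hiS]
          rw [Tg_mul, Tg_mul]
          congr 2
          have h := Equiv.swap_mul_swap_mul_swap (x := a) (y := i) (z := b)
          ext w
          simp only [Equiv.Perm.mul_apply, Equiv.swap_apply_def]
          split_ifs <;> simp_all
    · have hbS : b ∈ S := (Finset.mem_insert.1 hb).resolve_left hbv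
      conv_rhs => rw [← hinv a haS b hbS]
      rw [Tg_mul, Tg_mul, Equiv.mul_swap_eq_swap_mul,
        Equiv.swap_apply_of_ne_of_ne (Ne.symm hav) (Ne.symm hbv)]
  have main : ∀ a ∈ insert v S, ∀ b ∈ insert v S, a ≠ v →
      Tg (Equiv.swap a b) (∑ i ∈ insert v S, Tg (Equiv.swap i v) z) =
        ∑ i ∈ insert v S, Tg (Equiv.swap i v) z := by
    intro a ha b hb hav
    rw [map_sum, Finset.sum_congr rfl (key a ha b hb hav)]
    exact Finset.sum_nbij' (Equiv.swap a b) (Equiv.swap a b) (fun i hi => swap_mem ha hb i hi)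
      (fun i hi => swap_mem ha hb i hi) (fun i _ => Equiv.swap_apply_self _ _ _)
      (fun i _ => Equiv.swap_apply_self _ _ _) (fun i _ => rfl)
  intro a ha b hb
  by_cases hav : a = v
  · by_cases hbv : b = v
    · subst hav; subst hbv
      rw [Equiv.swap_self, map_sum]
      refine Finset.sum_congr rfl fun i hi => ?_
      rw [show Equiv.refl (Fin n) = 1 from rfl, Tg_mul, one_mul]
    · rw [Equiv.swap_comm]; exact main b hb a ha hbv
  · exact main a ha b hb hav

lemma count_id {A S : Finset (Fin n)} {r : ℕ} (hS : S ⊆ A) {z} (hz : z ∈ C A r)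
    (hinv : ∀ a ∈ S, ∀ b ∈ S, Tg (Equiv.swap a b) z = z) :
    ((A.card : ℤ) - (S.card : ℤ) * S.card) • z =
      ∑ v ∈ A \ S, ∑ i ∈ insert v S, Tg (Equiv.swap i v) z - ∑ i ∈ S, XX A i z := by
  have h1 : ∑ v ∈ A \ S, ∑ i ∈ insert v S, Tg (Equiv.swap i v) z =
      ((A.card : ℤ) - S.card) • z + ∑ i ∈ S, ∑ v ∈ A \ S, Tg (Equiv.swap v i) z := by
    rw [Finset.sum_comm (s := S), ← Nat.cast_sub (Finset.card_le_card hS),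
      ← Finset.card_sdiff_of_subset hS, Nat.cast_smul_eq_nsmul, ← Finset.sum_const,
      ← Finset.sum_add_distrib]
    refine Finset.sum_congr rfl fun v hv => ?_
    rw [Finset.sum_insert (Finset.mem_sdiff.1 hv).2, Equiv.swap_self]
    congr 1
    · exact Tg_one hz
    · exact Finset.sum_congr rfl fun i _ => by rw [Equiv.swap_comm]
  have h2 : ∀ i ∈ S, XX A i z = ((S.card : ℤ) - 1) • z + ∑ v ∈ A \ S, Tg (Equiv.swap v i) z := by
    intro i hi
    rw [XX, LinearMap.sum_apply]
    have : A.erase i = S.erase i ∪ (A \ S) := by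
      ext w
      simp only [Finset.mem_erase, Finset.mem_union, Finset.mem_sdiff]
      constructor
      · rintro ⟨h1, h2⟩
        by_cases hw : w ∈ S
        · exact Or.inl ⟨h1, hw⟩
        · exact Or.inr ⟨h2, hw⟩
      · rintro (⟨h1, h2⟩ | ⟨h1, h2⟩)
        · exact ⟨h1, hS h2⟩
        · exact ⟨fun h => h2 (h ▸ hi), h1⟩
    rw [this, Finset.sum_union]
    · congr 1
      rw [Finset.sum_congr rfl fun x hx => hinv x (Finset.mem_of_mem_erase hx) i hi,
        Finset.sum_const, Finset.card_erase_of_mem hi, ← Nat.cast_smul_eq_nsmul ℤ,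
        Nat.cast_sub (Finset.card_pos.2 ⟨i, hi⟩), Nat.cast_one]
    · rw [Finset.disjoint_left]
      intro w hw hw2
      exact (Finset.mem_sdiff.1 hw2).2 (Finset.mem_of_mem_erase hw)
  rw [h1, Finset.sum_congr rfl h2, Finset.sum_add_distrib, Finset.sum_const,
    ← Nat.cast_smul_eq_nsmul ℤ, smul_smul, add_sub_add_right_eq_sub, ← sub_smul]
  congr 1
  ring

lemma claim3 {n0 r : ℕ} (hsq : ∀ k : ℕ, (n0 : ℤ) ≠ (k : ℤ) * k) {N : ℤ} (hN0 : N ≠ 0)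
    (hN : ∀ A : Finset (Fin n), A.card = n0 → ∀ v ∈ A, ∀ z ∈ C A r, dd (rankP n) z = 0 →
      N • XX A v z ∈ Bd A r) (m : ℕ) :
    ∃ M : ℤ, M ≠ 0 ∧ ∀ A S : Finset (Fin n), A.card = n0 → S ⊆ A → S.card + m = n0 →
      ∀ z ∈ C A r, dd (rankP n) z = 0 → (∀ a ∈ S, ∀ b ∈ S, Tg (Equiv.swap a b) z = z) →
      M • z ∈ Bd A r := by
  have step : ∀ (m k : ℕ) (M : ℤ), M ≠ 0 → k + m = n0 →
      (∀ A S : Finset (Fin n), A.card = n0 → S ⊆ A → S.card = k →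
        ∀ z ∈ C A r, dd (rankP n) z = 0 → (∀ a ∈ S, ∀ b ∈ S, Tg (Equiv.swap a b) z = z) →
        ∀ v ∈ A \ S, M • ∑ i ∈ insert v S, Tg (Equiv.swap i v) z ∈ Bd A r) →
      ∃ M : ℤ, M ≠ 0 ∧ ∀ A S : Finset (Fin n), A.card = n0 → S ⊆ A → S.card + m = n0 →
        ∀ z ∈ C A r, dd (rankP n) z = 0 → (∀ a ∈ S, ∀ b ∈ S, Tg (Equiv.swap a b) z = z) →
        M • z ∈ Bd A r := by
    intro m k M hM hk h
    refine ⟨N * M * ((n0 : ℤ) - (k : ℤ) * k), mul_ne_zero (mul_ne_zero hN0 hM)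
      (sub_ne_zero.2 (hsq k)), ?_⟩
    intro A S hA hSA hS z hz hc hinv
    obtain rfl : S.card = k := by omega
    have := count_id hSA hz hinv
    rw [hA] at this
    rw [mul_smul, this, smul_sub, Finset.smul_sum, Finset.smul_sum]
    refine Submodule.sub_mem _ (Submodule.sum_mem _ fun v hv => ?_)
      (Submodule.sum_mem _ fun i hi => ?_)
    · rw [mul_smul]
      exact Submodule.smul_mem _ _ (h A S hA hSA rfl z hz hc hinv v hv)
    · rw [mul_comm, mul_smul]
      exact Submodule.smul_mem _ _ (hN A hA i (hSA hi) z hz hc)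
  induction m with
  | zero =>
    refine step 0 n0 1 one_ne_zero (by omega) ?_
    intro A S hA hSA hS z hz hc hinv v hv
    have : S = A := Finset.eq_of_subset_of_card_le hSA (by omega)
    simp [this] at hv
  | succ m ih =>
    obtain ⟨M, hM, h⟩ := ih
    · by_cases hm : m + 1 ≤ n0
      · refine step (m + 1) (n0 - (m + 1)) M hM (by omega) ?_
        intro A S hA hSA hS z hz hc hinv v hv
        obtain ⟨hvA, hvS⟩ := Finset.mem_sdiff.1 hv
        refine h A (insert v S) hA (Finset.insert_subset hvA hSA)
          (by rw [Finset.card_insert_of_notMem hvS]; omega) _ ?_ ?_ (sum_inv hSA hvS hz hinv)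
        · refine Submodule.sum_mem _ fun i hi => Tg_mem _ (swap_mem ?_ hvA) hz
          rcases Finset.mem_insert.1 hi with rfl | hi
          · exact hvA
          · exact hSA hi
        · rw [map_sum]
          refine Finset.sum_eq_zero fun i _ => ?_
          rw [← Tg_dd, hc, map_zero]
      · exact ⟨1, one_ne_zero, fun A S _ _ h => by omega⟩

theorem torsion (r : ℕ) (hr : r ≤ 5) :
    ∃ N : ℤ, N ≠ 0 ∧ ∀ A : Finset (Fin n), A.card = 2 * r + 4 → ∀ z ∈ C A r,
      dd (rankP n) z = 0 → N • z ∈ Bd A r := by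
  induction r with
  | zero =>
    refine ⟨1, one_ne_zero, fun A hA z hz _ => ?_⟩
    rw [one_smul]
    exact Bd_zero A (by omega) hz
  | succ r ih =>
    obtain ⟨N, hN, h⟩ := ih (by omega)
    obtain ⟨M, hM, h2⟩ := claim3 (n := n) (n0 := 2 * (r + 1) + 4) (r := r + 1) (N := N) (by
      intro k hk
      have hk2 : 2 * (r + 1) + 4 = k * k := by exact_mod_cast hk
      have : k ≤ 3 := by nlinarith
      interval_cases k <;> omega) hN (fun A hA v hv z hz hc =>
        claim2 (fun A' hA' => h A' (by omega)) hv hz hc) (2 * r + 5)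
    refine ⟨M, hM, fun A hA z hz hc => ?_⟩
    obtain ⟨a, ha⟩ : A.Nonempty := Finset.card_pos.1 (by omega)
    refine h2 A {a} hA (by simpa using ha) (by simp; omega) z hz hc ?_
    intro b hb c hc
    rw [Finset.mem_singleton] at hb hc
    subst hb; subst hc
    rw [Equiv.swap_self]
    exact Tg_one hz

end
end M14

/-! ### Comparison with the chain groups of the statement -/

namespace M14

open MatchPaper

noncomputable section

variable {n : ℕ}

/-- The inclusion of the chains of the matching complex. -/
def iota (n c : ℕ) : SChain ℤ (IsMatching n) c →ₗ[ℤ] TT (Fin n × Fin n) :=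
  Finsupp.lmapDomain ℤ ℤ Subtype.val

lemma iota_single {c : ℕ} (σ : {σ : Finset (Fin n × Fin n) // IsMatching n σ ∧ σ.card = c}) :
    iota n c (Finsupp.single σ 1) = Finsupp.single σ.1 1 := by
  simp [iota]

lemma iota_inj (n c : ℕ) : Function.Injective (iota n c) :=
  Finsupp.mapDomain_injective Subtype.val_injective

lemma Mt_univ (r : ℕ) (σ : Finset (Fin n × Fin n)) :
    Mt Finset.univ r σ ↔ IsMatching n σ ∧ σ.card = r := by
  rw [Mt, match_iff]; simp

lemma schain_ext {c : ℕ} {M : Type*} [AddCommGroup M] (f g : SChain ℤ (IsMatching n) c →ₗ[ℤ] M)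
    (h : ∀ σ, f (Finsupp.single σ 1) = g (Finsupp.single σ 1)) : f = g := by
  apply Finsupp.lhom_ext'
  intro σ
  apply LinearMap.ext_ring
  simpa using h σ

lemma iota_bdry (c : ℕ) (x : SChain ℤ (IsMatching n) (c + 1)) :
    iota n c (bdry ℤ (rankP n) (IsMatching n) c x) = dd (rankP n) (iota n (c + 1) x) := by
  suffices h : (iota n c) ∘ₗ (bdry ℤ (rankP n) (IsMatching n) c) =
      (dd (rankP n)) ∘ₗ (iota n (c + 1)) by
    exact congrArg (fun F => F x) h
  apply schain_ext
  intro σ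
  rw [LinearMap.comp_apply, LinearMap.comp_apply, iota_single, D_single]
  have : bdry ℤ (rankP n) (IsMatching n) c (Finsupp.single σ 1) =
      ∑ v ∈ σ.1, ((-1 : ℤ) ^ ((σ.1.filter fun u => rankP n u < rankP n v).card) •
      basisOrZero ℤ (IsMatching n) c (σ.1.erase v)) := by
    simp [bdry]
  rw [this, map_sum]
  refine Finset.sum_congr rfl fun v hv => ?_
  have h := (Mt_univ _ _).1 (Mt_erase ((Mt_univ _ _).2 σ.2) v hv)
  rw [map_smul, basisOrZero, dif_pos h, iota_single, one_mul]
  rfl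

lemma iota_mem (c : ℕ) (x : SChain ℤ (IsMatching n) c) : iota n c x ∈ C Finset.univ c := by
  induction x using Finsupp.induction_linear with
  | zero => simp
  | add f g hf hg => rw [map_add]; exact Submodule.add_mem _ hf hg
  | single σ a =>
    rw [← mul_one a, ← smul_eq_mul, ← Finsupp.smul_single, map_smul, iota_single]
    exact Submodule.smul_mem _ _ (single_mem ((Mt_univ _ _).2 σ.2))

lemma iota_surj (c : ℕ) {y} (hy : y ∈ C (Finset.univ : Finset (Fin n)) c) :
    ∃ x, iota n c x = y := by
  have := C_map (A := Finset.univ) (r := c) LinearMap.id (LinearMap.range (iota n c))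
    (fun σ hσ => ⟨Finsupp.single ⟨σ, (Mt_univ _ _).1 hσ⟩ 1, iota_single _⟩) hy
  exact this

theorem finite_MH : Finite (MH ℤ 14 4) := by
  obtain ⟨N, hN, h⟩ := torsion (n := 14) 5 le_rfl
  have hfin : Module.Finite ℤ (MH ℤ 14 4) := by
    have : Module.Finite ℤ (cycLow ℤ (rankP 14) (IsMatching 14) 5) := inferInstance
    exact Module.Finite.quotient ℤ _
  apply Module.finite_of_fg_torsion
  intro x
  refine ⟨⟨N, mem_nonZeroDivisors_of_ne_zero hN⟩, ?_⟩
  obtain ⟨⟨z, hz⟩, rfl⟩ := Submodule.Quotient.mk_surjective _ x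
  have hz' : bdry ℤ (rankP 14) (IsMatching 14) 4 z = 0 := hz
  obtain ⟨w, hw, hw2⟩ := h Finset.univ (by simp) (iota 14 5 z) (iota_mem _ _)
    (by rw [← iota_bdry, hz', map_zero])
  obtain ⟨w, rfl⟩ := iota_surj _ hw
  have hb : bdry ℤ (rankP 14) (IsMatching 14) 5 w = N • z := by
    apply iota_inj
    rw [iota_bdry, hw2, map_smul]
  change N • (Submodule.Quotient.mk ⟨z, hz⟩ : MH ℤ 14 4) = 0
  rw [← Submodule.Quotient.mk_smul, Submodule.Quotient.mk_eq_zero, Submodule.mem_comap]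
  exact ⟨w, hb⟩

theorem final_of_cocycle (F : TT (Fin 14 × Fin 14) →ₗ[ℤ] ZMod 15)
    (hF : ∀ y ∈ C Finset.univ 6, F (dd (rankP 14) y) = 0)
    (z : TT (Fin 14 × Fin 14)) (hz : z ∈ C Finset.univ 5) (hc : dd (rankP 14) z = 0)
    (hFz : IsUnit (F z)) :
    Finite (MH ℤ 14 4) ∧ 15 ∣ AddMonoid.exponent (MH ℤ 14 4) ∧
      (∃ x : MH ℤ 14 4, addOrderOf x = 3) ∧ (∃ x : MH ℤ 14 4, addOrderOf x = 5) := by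
  have hfin := finite_MH
  let G : cycLow ℤ (rankP 14) (IsMatching 14) 5 →ₗ[ℤ] ZMod 15 :=
    F ∘ₗ iota 14 5 ∘ₗ Submodule.subtype _
  let φ : MH ℤ 14 4 →ₗ[ℤ] ZMod 15 := Submodule.liftQ _ G (by
    rintro ⟨x, hx⟩ ⟨w, hw⟩
    change F (iota 14 5 x) = 0
    have hw' : bdry ℤ (rankP 14) (IsMatching 14) 5 w = x := hw
    rw [← hw', iota_bdry]
    exact hF _ (iota_mem _ _))
  obtain ⟨x, rfl⟩ := iota_surj _ hz
  have hx : x ∈ cycLow ℤ (rankP 14) (IsMatching 14) 5 := by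
    change bdry ℤ (rankP 14) (IsMatching 14) 4 x = 0
    apply iota_inj
    rw [iota_bdry, hc, map_zero]
  have hsurj : Function.Surjective φ := by
    intro c
    obtain ⟨u, hu⟩ := hFz
    refine ⟨((c * ↑u⁻¹ : ZMod 15).val : ℤ) • Submodule.Quotient.mk ⟨x, hx⟩, ?_⟩
    have h1 : φ (Submodule.Quotient.mk ⟨x, hx⟩) = F (iota 14 5 x) := rfl
    rw [map_smul, h1, ← hu, zsmul_eq_mul]
    push_cast
    rw [ZMod.natCast_val, ZMod.cast_id, mul_assoc, Units.inv_mul, mul_one]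
  have hcard : 15 ∣ Nat.card (MH ℤ 14 4) := by
    have := AddSubgroup.card_dvd_of_surjective φ.toAddMonoidHom hsurj
    simpa using this
  have : Fact (Nat.Prime 3) := ⟨by norm_num⟩
  have : Fact (Nat.Prime 5) := ⟨by norm_num⟩
  obtain ⟨a, ha⟩ := exists_prime_addOrderOf_dvd_card' (G := MH ℤ 14 4) 3
    (Dvd.dvd.trans (by norm_num) hcard)
  obtain ⟨b, hb⟩ := exists_prime_addOrderOf_dvd_card' (G := MH ℤ 14 4) 5
    (Dvd.dvd.trans (by norm_num) hcard)
  refine ⟨hfin, ?_, ⟨a, ha⟩, ⟨b, hb⟩⟩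
  have h3 : 3 ∣ AddMonoid.exponent (MH ℤ 14 4) := ha ▸ AddMonoid.addOrder_dvd_exponent a
  have h5 : 5 ∣ AddMonoid.exponent (MH ℤ 14 4) := hb ▸ AddMonoid.addOrder_dvd_exponent b
  exact Nat.Coprime.mul_dvd_of_dvd_of_dvd (by norm_num : Nat.Coprime 3 5) h3 h5

end
end M14

/-! ### The finite computation: a cocycle modulo 15 -/

namespace M14

/-- Comparison sign. -/
def cmp (a b : ℕ) : ℤ := bif Nat.blt a b then 1 else bif Nat.blt b a then -1 else 0

/-- Sign of `a` against the elements of a list. -/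
def sgc (a : ℕ) : List ℕ → ℤ
  | [] => 1
  | b :: l => cmp a b * sgc a l

/-- Sign of a list, zero if there are repeated entries. -/
def sg : List ℕ → ℤ
  | [] => 1
  | a :: l => sgc a l * sg l

/-- Lookup in an association list. -/
def look (k : ℕ) : List (ℕ × ℤ) → ℤ
  | [] => 0
  | p :: t => bif Nat.beq k p.1 then p.2 else look k t

/-- The values of the cocycle. -/
def tab : List (ℕ × ℤ) :=
  [(4294688, 3), (4359200, 1), (4360208, -4), (4391456, -1), (4392968, 4), (4423712, -1),
   (4425728, -4), (8487968, 6), (8488976, 6), (8553488, 3), (8585744, 6), (8586248, 6),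
   (8618000, 6), (8619008, -6), (12648736, -6), (12650500, -6), (12681248, -6), (12683264, 6),
   (12714256, -4), (12715012, 1), (12746768, -4), (12747776, -1), (12779522, -7),
   (12779528, -5), (12779536, -6), (12779552, 1), (12779776, -5), (12780544, 1),
   (12781568, -6), (12812288, -7), (536969760, -6), (536971272, -6), (537035280, 6),
   (537035784, 6), (537068040, 3), (537100296, -6), (537100800, 6), (541098272, 6),
   (541100036, 6), (541163552, 6), (541165568, -6), (541196552, 4), (541196804, -1),
   (541229058, -7), (541229060, -1), (541229064, -5), (541229072, -6), (541229312, 6),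
   (541230080, 1), (541231104, 5), (541261832, -4), (541262336, -1), (541294592, -7),
   (545292560, -6), (545293316, -6), (545325320, 6), (545325572, 6), (545357826, -3),
   (545357828, 6), (545357856, -6), (545358080, -6), (545359872, 6), (545423376, 6),
   (545424384, -6), (545456136, -6), (545456640, 6), (545488896, -3), (549454084, 3),
   (549486596, -6), (549486848, 6), (549519364, 6), (549519616, -6), (549552128, -3),
   (549584900, -1), (549585152, -4), (549617664, -7), (549650432, -7)]

/-- Key of a set of codes. -/
def key : List ℕ → ℕ
  | [] => 0
  | c :: l => 2 ^ c + key l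

/-- Is there a loop? -/
def hasLoop : List ℕ → Bool
  | [] => false
  | c :: l => Nat.beq (c / 6) (c % 6) || hasLoop l

/-- The cocycle on lists of codes. -/
def gc (cs : List ℕ) : ℤ := bif hasLoop cs then 0 else sg cs * look (key cs) tab

/-- All ways of taking out an element of a list, with signs. -/
def terms {α : Type*} : List α → List (ℤ × α × List α)
  | [] => []
  | e :: l => (1, e, l) :: (terms l).map fun t => (-t.1, t.2.1, e :: t.2.2)

/-- Block structure. -/
def blocks : List ℕ → List ℕ
  | [] => []
  | c :: l => c / 6 :: c % 6 :: blocks l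

/-- The coboundary. -/
def Hc (L ρ : List ℕ) : ℤ :=
  ((terms L).map fun t => t.1 * sg (t.2.1 / 6 :: t.2.1 % 6 :: ρ) * gc t.2.2).sum

/-- All blocks of the fourteen vertices. -/
def allB : List ℕ := [0, 1, 2, 2, 2, 3, 3, 3, 4, 4, 4, 5, 5, 5]

/-- The codes of the edges between different blocks. -/
def allC : List ℕ := [1, 2, 3, 4, 5, 8, 9, 10, 11, 15, 16, 17, 22, 23, 29]

/-- Size bound for one code to be put in front. -/
def okc (R : List ℕ) (b : ℕ) : Bool := Nat.ble (R.count b) (allB.count b)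

/-- Is `c` smaller than the head? -/
def lth (c : ℕ) : List ℕ → Bool
  | [] => true
  | b :: _ => Nat.blt c b

/-- The final test. -/
def test (L : List ℕ) : Bool := Int.emod (Hc L (allB.diff (blocks L))) 15 == 0

/-- Exhaustive search. -/
def chk : ℕ → List ℕ → Bool
  | 0, L => test L
  | k + 1, L => allC.all fun c =>
      bif lth c L && okc (blocks (c :: L)) (c / 6) && okc (blocks (c :: L)) (c % 6) then
        chk k (c :: L) else true

set_option maxRecDepth 100000 in
lemma chk_all : chk 6 [] = true := by decide +kernel

end M14

/-! ### The cocycle on the matching complex -/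

namespace M14

open MatchPaper

noncomputable section

lemma cmp_anti (a b : ℕ) : cmp a b = - cmp b a := by
  unfold cmp
  rcases lt_trichotomy a b with h | h | h
  · have h2 : ¬ b < a := by omega
    rw [show Nat.blt a b = true from by simpa using h, show Nat.blt b a = false from by
      rw [Bool.eq_false_iff]; simpa using h2]; rfl
  · subst h
    rw [show Nat.blt a a = false from by rw [Bool.eq_false_iff]; simp]; rfl
  · have h2 : ¬ a < b := by omega
    rw [show Nat.blt b a = true from by simpa using h, show Nat.blt a b = false from by
      rw [Bool.eq_false_iff]; simpa using h2]; rfl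

lemma sgc_swap (x : ℕ) (pre : List ℕ) (a b : ℕ) (l : List ℕ) :
    sgc x (pre ++ a :: b :: l) = sgc x (pre ++ b :: a :: l) := by
  induction pre with
  | nil => simp only [List.nil_append, sgc]; ring
  | cons y pre ih => simp only [List.cons_append, sgc, ih]

lemma sg_alt : Alt sg := by
  intro pre a b l
  induction pre with
  | nil => simp only [List.nil_append, sg, sgc]; rw [cmp_anti a b]; ring
  | cons y pre ih => simp only [List.cons_append, sg, ih, sgc_swap y pre a b l]; ring

lemma sg_swap2 (pre : List ℕ) (a b c d : ℕ) (l : List ℕ) :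
    sg (pre ++ a :: b :: c :: d :: l) = sg (pre ++ c :: d :: a :: b :: l) := by
  have h1 := sg_alt (pre ++ [a]) b c (d :: l)
  have h2 := sg_alt pre a c (b :: d :: l)
  have h3 := sg_alt (pre ++ [c, a]) b d l
  have h4 := sg_alt (pre ++ [c]) a d (b :: l)
  simp only [List.append_assoc, List.cons_append, List.nil_append] at h1 h2 h3 h4
  rw [h1, h2, h3, h4]; ring

/-- The list of vertices of a list of edges. -/
def word : List (Fin 14 × Fin 14) → List ℕ
  | [] => []
  | p :: l => p.1.val :: p.2.val :: word l

lemma sg_word {l l' : List (Fin 14 × Fin 14)} (h : l.Perm l') :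
    ∀ pre u, sg (pre ++ (word l ++ u)) = sg (pre ++ (word l' ++ u)) := by
  induction h with
  | nil => intro pre u; rfl
  | cons p _ ih =>
    intro pre u
    have := ih (pre ++ [p.1.val, p.2.val]) u
    simpa [word] using this
  | swap p q l =>
    intro pre u
    simp only [word, List.cons_append]
    exact sg_swap2 _ _ _ _ _ _
  | trans _ _ h1 h2 => intro pre u; rw [h1, h2]

lemma sg_move (m : List (Fin 14 × Fin 14)) (x y : ℕ) (u : List ℕ) :
    ∀ pre, sg (pre ++ (word m ++ x :: y :: u)) = sg (pre ++ x :: y :: (word m ++ u)) := by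
  induction m with
  | nil => intro pre; rfl
  | cons p m ih =>
    intro pre
    have := ih (pre ++ [p.1.val, p.2.val])
    simp only [List.append_assoc, List.cons_append, List.nil_append] at this
    simp only [word, List.cons_append]
    rw [this, sg_swap2]

lemma mem_word (l : List (Fin 14 × Fin 14)) (v : ℕ) :
    v ∈ word l ↔ ∃ p ∈ l, v = p.1.val ∨ v = p.2.val := by
  induction l with
  | nil => simp [word]
  | cons p l ih => simp [word, ih, or_assoc]

lemma word_perm {l l' : List (Fin 14 × Fin 14)} (h : l.Perm l') : (word l).Perm (word l') := by
  induction h with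
  | nil => exact List.Perm.refl _
  | cons p _ ih => exact (ih.cons _).cons _
  | swap p q l =>
    simp only [word]
    rw [List.perm_iff_count]
    intro a
    simp only [List.count_cons]
    omega
  | trans _ _ h1 h2 => exact h1.trans h2

/-- The uncovered vertices. -/
def unc (l : List (Fin 14 × Fin 14)) : List ℕ := (List.range 14).filter fun v => v ∉ word l

lemma unc_perm {l l' : List (Fin 14 × Fin 14)} (h : l.Perm l') : unc l = unc l' := by
  unfold unc
  apply List.filter_congr
  intro v _
  simp only [(word_perm h).mem_iff]

/-- The block of a vertex. -/
def kap (v : ℕ) : ℕ := if v < 2 then v else (v + 4) / 3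

/-- The code of an edge. -/
def code (p : Fin 14 × Fin 14) : ℕ := 6 * kap p.1.val + kap p.2.val

lemma kap_lt (v : Fin 14) : kap v.val < 6 := by revert v; decide

lemma code_div (p : Fin 14 × Fin 14) : code p / 6 = kap p.1.val := by
  have := kap_lt p.2; unfold code; omega

lemma code_mod (p : Fin 14 × Fin 14) : code p % 6 = kap p.2.val := by
  have := kap_lt p.2; unfold code; omega

lemma key_perm {l l' : List ℕ} (h : l.Perm l') : key l = key l' := by
  induction h with
  | nil => rfl
  | cons p _ ih => simp only [key, ih]
  | swap p q l => simp only [key]; omega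
  | trans _ _ h1 h2 => exact h1.trans h2

lemma hasLoop_perm {l l' : List ℕ} (h : l.Perm l') : hasLoop l = hasLoop l' := by
  induction h with
  | nil => rfl
  | cons p _ ih => simp only [hasLoop, ih]
  | swap p q l => simp only [hasLoop, Bool.or_left_comm]
  | trans _ _ h1 h2 => exact h1.trans h2

lemma swap_perm {α : Type*} (pre : List α) (a b : α) (l : List α) :
    (pre ++ a :: b :: l).Perm (pre ++ b :: a :: l) :=
  List.Perm.append_left _ (List.Perm.swap _ _ _)

lemma gc_alt : Alt gc := by
  intro pre a b l
  unfold gc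
  rw [hasLoop_perm (swap_perm pre a b l), key_perm (swap_perm pre a b l), sg_alt pre a b l]
  cases hasLoop (pre ++ b :: a :: l) <;> simp

/-- The cocycle. -/
def g0 (l : List (Fin 14 × Fin 14)) : ℤ :=
  sg (word l ++ unc l) * sg ((unc l).map kap) * gc (l.map code)

lemma g0_alt : Alt g0 := by
  intro pre a b l
  unfold g0
  have h1 := sg_word (swap_perm pre a b l) [] (unc (pre ++ a :: b :: l))
  have h2 := gc_alt (pre.map code) (code a) (code b) (l.map code)
  simp only [List.nil_append] at h1
  simp only [List.map_append, List.map_cons] at h2 ⊢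
  rw [h1, h2, unc_perm (swap_perm pre a b l)]
  ring

section Terms

variable {E : Type*} [DecidableEq E] {rk : E → ℕ}

lemma D_o (hrk : Function.Injective rk) (φ : E → ℤ) (l : List E) :
    D rk φ (o rk l) = ((terms l).map fun t => (t.1 * φ t.2.1) • o rk t.2.2).sum := by
  induction l with
  | nil => simp [o, D_single, terms]
  | cons e l ih =>
    rw [o, DW hrk, ih, terms, List.map_cons, List.sum_cons, one_mul, sub_eq_add_neg, List.map_map]
    congr 1
    generalize terms l = L
    induction L with
    | nil => simp
    | cons t L ih2 =>
      simp only [List.map_cons, List.sum_cons, map_add, neg_add, ih2]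
      congr 1
      simp [o]

lemma terms_perm (l : List E) : ∀ t ∈ terms l, l.Perm (t.2.1 :: t.2.2) := by
  induction l with
  | nil => simp [terms]
  | cons e l ih =>
    intro t ht
    rw [terms, List.mem_cons, List.mem_map] at ht
    rcases ht with rfl | ⟨s, hs, rfl⟩
    · exact List.Perm.refl _
    · exact ((ih s hs).cons e).trans (List.Perm.swap _ _ _)

lemma terms_map {β : Type*} (f : E → β) (l : List E) :
    terms (l.map f) = (terms l).map fun t => (t.1, f t.2.1, t.2.2.map f) := by
  induction l with
  | nil => rfl
  | cons e l ih =>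
    rw [List.map_cons, terms, terms, List.map_cons, ih, List.map_map, List.map_map]
    rfl

lemma lift_o' (hrk : Function.Injective rk) (g : List E → ℤ) (hg : Alt g) (l : List E) :
    lift hrk g (o rk l) = g l := by
  by_cases h : l.Nodup
  · exact lift_o hrk g hg l h
  · rw [o_dup hrk l h, map_zero, alt_dup g hg (fun x hx => by omega) l h]

end Terms

lemma Hc_dup (L ρ : List ℕ) (h : ¬ L.Nodup) : Hc L ρ = 0 := by
  have hid : Function.Injective (id : ℕ → ℕ) := Function.injective_id
  have h1 := congrArg (lift hid gc)
    (D_o (rk := id) hid (fun e => sg (e / 6 :: e % 6 :: ρ)) L)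
  rw [o_dup hid L h, map_zero, map_zero, map_list_sum, List.map_map] at h1
  rw [Hc, h1]
  congr 1
  apply List.map_congr_left
  intro t _
  simp only [Function.comp, map_smul, lift_o' hid gc gc_alt, smul_eq_mul]

lemma sg_loop (c : ℕ) (ρ : List ℕ) (h : c / 6 = c % 6) : sg (c / 6 :: c % 6 :: ρ) = 0 := by
  apply alt_dup sg sg_alt (fun x hx => by omega)
  simp [h]

lemma Hc_loop (L ρ : List ℕ) (h : hasLoop L = true) : Hc L ρ = 0 := by
  unfold Hc
  apply List.sum_eq_zero
  intro x hx
  rw [List.mem_map] at hx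
  obtain ⟨t, ht, rfl⟩ := hx
  have hp := terms_perm L t ht
  rw [hasLoop_perm hp, hasLoop, Bool.or_eq_true, Nat.beq_eq] at h
  rcases h with h | h
  · rw [sg_loop _ _ h]; simp
  · simp [gc, h]

lemma unc_cons {l m : List (Fin 14 × Fin 14)} {e : Fin 14 × Fin 14} (hp : l.Perm (e :: m))
    (hw : (word l).Nodup) : (unc m).Perm (e.1.val :: e.2.val :: unc l) := by
  have hw2 : (word (e :: m)).Nodup := (word_perm hp).nodup_iff.1 hw
  rw [unc_perm hp]
  simp only [word, List.nodup_cons, List.mem_cons, not_or] at hw2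
  obtain ⟨⟨h1, h2⟩, h3, -⟩ := hw2
  rw [List.perm_ext_iff_of_nodup]
  · intro a
    have e1 := e.1.2
    have e2 := e.2.2
    simp only [unc, List.mem_filter, List.mem_range, List.mem_cons, word, decide_eq_true_eq]
    constructor
    · rintro ⟨h4, h5⟩
      by_cases h6 : a = e.1.val
      · exact Or.inl h6
      · by_cases h7 : a = e.2.val
        · exact Or.inr (Or.inl h7)
        · exact Or.inr (Or.inr ⟨h4, by tauto⟩)
    · rintro (rfl | rfl | ⟨h4, h5⟩)
      · exact ⟨e1, h2⟩
      · exact ⟨e2, h3⟩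
      · exact ⟨h4, by tauto⟩
  · exact List.nodup_range.filter _
  · simp only [List.nodup_cons, List.mem_cons, not_or, unc, List.mem_filter, List.mem_range, word,
      decide_eq_true_eq]
    refine ⟨⟨h1, ?_⟩, ?_, List.nodup_range.filter _⟩
    · tauto
    · tauto

lemma g0_term {l m : List (Fin 14 × Fin 14)} {e : Fin 14 × Fin 14} (hp : l.Perm (e :: m))
    (hw : (word l).Nodup) :
    g0 m = sg (word l ++ unc l) *
      (sg (kap e.1.val :: kap e.2.val :: (unc l).map kap) * gc (m.map code)) := by
  obtain ⟨ε, h1, h2, h3⟩ := alt_perm2 (unc_cons hp hw) (fun u => sg (word m ++ u))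
    (fun u => sg (u.map kap))
    (by intro pre a b l; simpa using sg_alt (word m ++ pre) a b l)
    (by intro pre a b l; simpa using sg_alt (pre.map kap) (kap a) (kap b) (l.map kap))
  have h4 := sg_move m e.1.val e.2.val (unc l) []
  have h5 := sg_word hp [] (unc l)
  simp only [List.nil_append, word, List.cons_append] at h4 h5
  simp only [smul_eq_mul, List.map_cons] at h2 h3
  unfold g0
  rw [h2, h3, h4, ← h5]
  rcases h1 with rfl | rfl <;> ring

lemma lift_dd (l : List (Fin 14 × Fin 14)) (hw : (word l).Nodup) :
    lift (rankP_inj 14) g0 (dd (rankP 14) (o (rankP 14) l)) =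
      sg (word l ++ unc l) * Hc (l.map code) ((unc l).map kap) := by
  rw [D_o (rankP_inj 14), map_list_sum, List.map_map, Hc, terms_map, List.map_map,
    ← List.sum_map_mul_left]
  congr 1
  apply List.map_congr_left
  intro t ht
  simp only [Function.comp, map_smul, lift_o' _ g0 g0_alt, smul_eq_mul, code_div, code_mod]
  rw [g0_term (terms_perm l t ht) hw]
  ring

lemma exists_sorted {E : Type*} [DecidableEq E] (f : E → ℕ) (σ : Finset E) :
    ∃ l : List E, l.Nodup ∧ l.toFinset = σ ∧ (l.map f).Pairwise (· ≤ ·) := by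
  induction' hn : σ.card with n ih generalizing σ
  · rw [Finset.card_eq_zero] at hn
    exact ⟨[], by simp, by simp [hn], by simp⟩
  · have hne : σ.Nonempty := by rw [← Finset.card_pos]; omega
    obtain ⟨e, he, hmin⟩ := Finset.exists_min_image σ f hne
    obtain ⟨l, h1, h2, h3⟩ := ih (σ.erase e) (by rw [Finset.card_erase_of_mem he]; omega)
    refine ⟨e :: l, ?_, ?_, ?_⟩
    · rw [List.nodup_cons]; refine ⟨?_, h1⟩
      rw [← List.mem_toFinset, h2]; simp
    · rw [List.toFinset_cons, h2, Finset.insert_erase he]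
    · rw [List.map_cons, List.pairwise_cons]
      refine ⟨?_, h3⟩
      intro b hb
      rw [List.mem_map] at hb
      obtain ⟨q, hq, rfl⟩ := hb
      rw [← List.mem_toFinset, h2] at hq
      exact hmin q (Finset.mem_of_mem_erase hq)

lemma blocks_word (l : List (Fin 14 × Fin 14)) : blocks (l.map code) = (word l).map kap := by
  induction l with
  | nil => rfl
  | cons p l ih => simp [blocks, word, ih, code_div, code_mod]

lemma kap_mono : Monotone kap := by
  intro a b h
  unfold kap
  split_ifs <;> omega

lemma word_lt (l : List (Fin 14 × Fin 14)) : ∀ v ∈ word l, v < 14 := by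
  intro v hv
  rw [mem_word] at hv
  obtain ⟨p, -, rfl | rfl⟩ := hv
  · exact p.1.2
  · exact p.2.2

lemma word_unc (l : List (Fin 14 × Fin 14)) (hw : (word l).Nodup) :
    (word l ++ unc l).Perm (List.range 14) := by
  rw [List.perm_ext_iff_of_nodup]
  · intro a
    simp only [unc, List.mem_append, List.mem_filter, List.mem_range, decide_eq_true_eq]
    have := word_lt l a
    tauto
  · rw [List.nodup_append']
    refine ⟨hw, List.nodup_range.filter _, ?_⟩
    intro a h1 h2
    simp [unc] at h2
    exact h2.2 h1
  · exact List.nodup_range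

lemma kap_range : (List.range 14).map kap = allB := by decide

lemma allB_perm (l : List (Fin 14 × Fin 14)) (hw : (word l).Nodup) :
    (blocks (l.map code) ++ (unc l).map kap).Perm allB := by
  rw [blocks_word, ← List.map_append, ← kap_range]
  exact (word_unc l hw).map kap

lemma unc_diff (l : List (Fin 14 × Fin 14)) (hw : (word l).Nodup) :
    allB.diff (blocks (l.map code)) = (unc l).map kap := by
  have hp := allB_perm l hw
  have hs : allB.Pairwise (· ≤ ·) := by decide
  have h1 : (allB.diff (blocks (l.map code))).Pairwise (· ≤ ·) :=
    hs.sublist (List.diff_sublist _ _)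
  have h2 : ((unc l).map kap).Pairwise (· ≤ ·) := by
    rw [← kap_range] at hs
    exact hs.sublist (List.Sublist.map _ List.filter_sublist)
  refine List.Perm.eq_of_pairwise (fun a b _ _ h h' => le_antisymm h h') h1 h2 ?_
  rw [List.perm_iff_count]
  intro a
  have := List.perm_iff_count.1 hp a
  rw [List.count_append] at this
  rw [List.count_diff]; omega

lemma chk_sound (k : ℕ) : ∀ L P : List ℕ, P.length = k → (P ++ L).Pairwise (· < ·) →
    (∀ c ∈ P, c ∈ allC) → (∀ b, (blocks (P ++ L)).count b ≤ allB.count b) → chk k L = true →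
    test (P ++ L) = true := by
  induction k with
  | zero =>
    intro L P h0 _ _ _ h
    rw [List.length_eq_zero_iff] at h0
    subst h0
    exact h
  | succ k ih =>
    intro L P h0 h1 h2 h3 h
    obtain ⟨Q, c, rfl⟩ : ∃ Q c, P = Q ++ [c] := by
      rcases List.eq_nil_or_concat P with rfl | ⟨Q, c, rfl⟩
      · simp at h0
      · exact ⟨Q, c, by simp⟩
    rw [List.append_assoc, List.singleton_append] at *
    apply ih (c :: L) Q (by simpa using h0) h1 (fun x hx => h2 x (by simp [hx])) h3
    rw [chk, List.all_eq_true] at h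
    have h4 := h c (h2 c (by simp))
    have hl : lth c L = true := by
      cases L with
      | nil => rfl
      | cons b L =>
        have := (List.pairwise_append.1 h1).2.1
        rw [List.pairwise_cons] at this
        simpa [lth] using this.1 b (by simp)
    have hsub : ∀ b, (blocks (c :: L)).count b ≤ allB.count b := by
      intro b
      refine le_trans ?_ (h3 b)
      have : ∀ Q M : List ℕ, (blocks M).count b ≤ (blocks (Q ++ M)).count b := by
        intro Q M
        induction Q with
        | nil => simp
        | cons x Q ih => simp only [List.cons_append, blocks, List.count_cons]; omega
      exact this _ _
    have ho : ∀ b, okc (blocks (c :: L)) b = true := by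
      intro b; unfold okc; exact Nat.ble_eq_true_of_le (hsub b)
    rw [hl, ho, ho] at h4
    simpa using h4

lemma hasLoop_false {L : List ℕ} (h : hasLoop L = false) : ∀ c ∈ L, c / 6 ≠ c % 6 := by
  induction L with
  | nil => simp
  | cons x L ih =>
    rw [hasLoop, Bool.or_eq_false_iff] at h
    intro c hc
    rw [List.mem_cons] at hc
    rcases hc with rfl | hc
    · intro h2; rw [h2] at h; simp at h
    · exact ih h.2 c hc

lemma code_mem (p : Fin 14 × Fin 14) (hp : p.1 < p.2) (h : code p / 6 ≠ code p % 6) :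
    code p ∈ allC := by
  rw [code_div, code_mod] at h
  have h1 : kap p.1.val < kap p.2.val := lt_of_le_of_ne (kap_mono (le_of_lt hp)) h
  have h2 := kap_lt p.2
  unfold code
  generalize kap p.1.val = a at *
  generalize kap p.2.val = b at *
  interval_cases b <;> interval_cases a <;> decide

lemma Hc_zero (l : List (Fin 14 × Fin 14)) (hlen : l.length = 6) (hw : (word l).Nodup)
    (hlt : ∀ p ∈ l, p.1 < p.2) (hs : (l.map code).Pairwise (· ≤ ·)) :
    (15 : ℤ) ∣ Hc (l.map code) ((unc l).map kap) := by
  by_cases hd : (l.map code).Nodup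
  · cases hl : hasLoop (l.map code)
    · have h := chk_sound 6 [] (l.map code) (by simpa using hlen) (by
          rw [List.append_nil]
          exact (hs.and hd).imp fun h => lt_of_le_of_ne h.1 h.2) (by
          intro c hc
          have := hasLoop_false hl c hc
          rw [List.mem_map] at hc
          obtain ⟨p, hp, rfl⟩ := hc
          exact code_mem p (hlt p hp) this) (by
          intro b
          rw [List.append_nil]
          have := List.perm_iff_count.1 (allB_perm l hw) b
          rw [List.count_append] at this
          omega) chk_all
      rw [List.append_nil, test, unc_diff l hw, beq_iff_eq] at h
      exact Int.dvd_of_emod_eq_zero h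
    · rw [Hc_loop _ _ hl]; simp
  · rw [Hc_dup _ _ hd]; simp

lemma word_nodup (l : List (Fin 14 × Fin 14)) (hn : l.Nodup) (hlt : ∀ p ∈ l, p.1 < p.2)
    (hm : ∀ p ∈ l, ∀ q ∈ l, ∀ w, inc w p → inc w q → p = q) : (word l).Nodup := by
  induction l with
  | nil => simp [word]
  | cons p l ih =>
    rw [List.nodup_cons] at hn
    have key : ∀ v, inc v p → v.val ∉ word l := by
      intro v hv h
      rw [mem_word] at h
      obtain ⟨q, hq, h⟩ := h
      have : p = q := hm p (by simp) q (by simp [hq]) v hv (by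
        rcases h with h | h
        · exact Or.inl (Fin.ext h)
        · exact Or.inr (Fin.ext h))
      exact hn.1 (this ▸ hq)
    simp only [word, List.nodup_cons, List.mem_cons, not_or]
    refine ⟨⟨?_, key _ (Or.inl rfl)⟩, key _ (Or.inr rfl), ih hn.2 (fun q hq => hlt q (by simp [hq]))
      fun q hq r hr => hm q (by simp [hq]) r (by simp [hr])⟩
    have := hlt p (by simp)
    exact (Fin.lt_def.1 this).ne

/-- The cocycle modulo 15 as a linear map. -/
def FF : TT (Fin 14 × Fin 14) →ₗ[ℤ] ZMod 15 :=
  (Int.castAddHom (ZMod 15)).toIntLinearMap ∘ₗ lift (rankP_inj 14) g0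

lemma FF_apply (x) : FF x = ((lift (rankP_inj 14) g0 x : ℤ) : ZMod 15) := rfl

lemma FF_dd (y) (hy : y ∈ C Finset.univ 6) : FF (dd (rankP 14) y) = 0 := by
  refine C_eq (A := Finset.univ) (r := 6) (FF ∘ₗ dd (rankP 14)) 0 ?_ hy
  intro σ hσ
  obtain ⟨l, h1, h2, h3⟩ := exists_sorted code σ
  obtain ⟨ε, h4, h5⟩ := o_single (rk := rankP 14) l h1
  have h6 : (Finsupp.single σ 1 : TT (Fin 14 × Fin 14)) = ε • o (rankP 14) l := by
    rw [h5, h2, smul_smul]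
    rcases h4 with rfl | rfl <;> simp
  have hmem : ∀ p, p ∈ l ↔ p ∈ σ := fun p => by rw [← h2, List.mem_toFinset]
  have hw : (word l).Nodup := word_nodup l h1 (fun p hp => hσ.1.1 p ((hmem p).1 hp))
    fun p hp q hq => hσ.1.2 p ((hmem p).1 hp) q ((hmem q).1 hq)
  have hlen : l.length = 6 := by
    rw [← List.toFinset_card_of_nodup h1, h2]; exact hσ.2.1
  have h7 := Hc_zero l hlen hw (fun p hp => hσ.1.1 p ((hmem p).1 hp)) h3
  rw [h6, map_smul, LinearMap.comp_apply, FF_apply, lift_dd l hw, LinearMap.zero_apply]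
  have : (((sg (word l ++ unc l) * Hc (l.map code) ((unc l).map kap) : ℤ)) : ZMod 15) = 0 := by
    rw [ZMod.intCast_zmod_eq_zero_iff_dvd] at *
    exact_mod_cast Dvd.dvd.mul_left h7 _
  rw [this, smul_zero]

end

end M14

/-! ### The cycle -/

namespace M14

open MatchPaper

noncomputable section

/-- Multiplication by an edge of the complete graph on fourteen vertices. -/
abbrev Wm (a b : Fin 14) : TT (Fin 14 × Fin 14) →ₗ[ℤ] TT (Fin 14 × Fin 14) :=
  W (rankP 14) (mk a b)

/-- Multiplication by the cycle of a path of length two. -/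
def tri (a b c : Fin 14) (x : TT (Fin 14 × Fin 14)) : TT (Fin 14 × Fin 14) := Wm a b x - Wm b c x

/-- A product of three such cycles. -/
def uu : TT (Fin 14 × Fin 14) := tri 5 2 11 (tri 10 3 9 (tri 6 8 7 (Finsupp.single ∅ 1)))

/-- Multiplication by the pentagon cycle. -/
def pent (a b c d e : Fin 14) (x : TT (Fin 14 × Fin 14)) : TT (Fin 14 × Fin 14) :=
  Wm a b (Wm c d x) + Wm c d (Wm e a x) + Wm e a (Wm b c x) + Wm b c (Wm d e x) +
    Wm d e (Wm a b x)

/-- The cycle. -/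
def zz : TT (Fin 14 × Fin 14) := pent 13 4 0 1 12 uu

lemma tri_dd (a b c : Fin 14) (x) (h : dd (rankP 14) x = 0) : dd (rankP 14) (tri a b c x) = 0 := by
  unfold tri
  rw [map_sub, DW (rankP_inj 14), DW (rankP_inj 14), h]; simp

lemma pent_dd (a b c d e : Fin 14) (x) (h : dd (rankP 14) x = 0) :
    dd (rankP 14) (pent a b c d e x) = 0 := by
  unfold pent
  simp only [map_add, DW (rankP_inj 14), h, one_smul, map_zero, sub_zero]
  abel

lemma uu_dd : dd (rankP 14) uu = 0 :=
  tri_dd _ _ _ _ (tri_dd _ _ _ _ (tri_dd _ _ _ _ (by simp [D_single])))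

lemma zz_dd : dd (rankP 14) zz = 0 := pent_dd _ _ _ _ _ _ uu_dd

lemma tri_mem {A' A : Finset (Fin 14)} {r : ℕ} (h : A' ⊆ A) (a b c : Fin 14) (hab : a ≠ b)
    (hbc : b ≠ c) (ha : a ∈ A) (hb : b ∈ A) (hc : c ∈ A) (ha' : a ∉ A') (hb' : b ∉ A')
    (hc' : c ∉ A') {x} (hx : x ∈ C A' r) : tri a b c x ∈ C A (r + 1) :=
  Submodule.sub_mem _ (W_mem h a b hab ha hb ha' hb' hx) (W_mem h b c hbc hb hc hb' hc' hx)

lemma WW_mem {A : Finset (Fin 14)} {r : ℕ} (a b c d : Fin 14) (hab : a ≠ b) (hcd : c ≠ d)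
    (ha : a ∉ insert c (insert d A)) (hb : b ∉ insert c (insert d A)) (hc : c ∉ A) (hd : d ∉ A)
    {x} (hx : x ∈ C A r) : Wm a b (Wm c d x) ∈ C Finset.univ (r + 2) :=
  W_mem (A' := insert c (insert d A)) (Finset.subset_univ _) a b hab (Finset.mem_univ _)
    (Finset.mem_univ _) ha hb
    (W_mem (A' := A) (fun v hv => by simp [hv]) c d hcd (by simp) (by simp) hc hd hx)

lemma empty_mem : (Finsupp.single ∅ 1 : TT (Fin 14 × Fin 14)) ∈ C (∅ : Finset (Fin 14)) 0 :=
  single_mem ⟨⟨by simp, by simp⟩, by simp, by simp⟩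

lemma uu_mem : uu ∈ C ({2, 3, 5, 6, 7, 8, 9, 10, 11} : Finset (Fin 14)) 3 := by
  have h1 := tri_mem (A := ({6, 7, 8} : Finset (Fin 14))) (by decide) 6 8 7 (by decide) (by decide)
    (by decide) (by decide) (by decide) (by decide) (by decide) (by decide) empty_mem
  have h2 := tri_mem (A := ({3, 6, 7, 8, 9, 10} : Finset (Fin 14))) (by decide) 10 3 9 (by decide)
    (by decide) (by decide) (by decide) (by decide) (by decide) (by decide) (by decide) h1
  exact tri_mem (by decide) 5 2 11 (by decide) (by decide) (by decide) (by decide) (by decide)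
    (by decide) (by decide) (by decide) h2

lemma zz_mem : zz ∈ C Finset.univ 5 := by
  unfold zz pent
  refine Submodule.add_mem _ (Submodule.add_mem _ (Submodule.add_mem _ (Submodule.add_mem _
    ?_ ?_) ?_) ?_) ?_
  all_goals
    exact WW_mem _ _ _ _ (by decide) (by decide) (by decide) (by decide) (by decide) (by decide)
      uu_mem

/-- Evaluation on the nine-vertex part. -/
def evu (pre : List (Fin 14 × Fin 14)) : ℤ :=
  ([(mk 5 2, 1), (mk 2 11, -1)].map fun a =>
    ([(mk 10 3, 1), (mk 3 9, -1)].map fun b =>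
      ([(mk 6 8, 1), (mk 8 7, -1)].map fun c =>
        a.2 * b.2 * c.2 * g0 (pre ++ [a.1, b.1, c.1])).sum).sum).sum

lemma evu_eq (p q : Fin 14 × Fin 14) :
    lift (rankP_inj 14) g0 (W (rankP 14) p (W (rankP 14) q uu)) = evu [p, q] := by
  have h : ∀ a b c, lift (rankP_inj 14) g0 (W (rankP 14) p (W (rankP 14) q (W (rankP 14) a
      (W (rankP 14) b (W (rankP 14) c (Finsupp.single ∅ 1)))))) = g0 [p, q, a, b, c] := by
    intro a b c
    exact lift_o' (rankP_inj 14) g0 g0_alt [p, q, a, b, c]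
  simp only [uu, tri, map_sub, h, evu, List.map_cons, List.map_nil, List.sum_cons, List.sum_nil,
    List.cons_append, List.nil_append]
  ring

set_option maxRecDepth 100000 in
lemma ev_val : (evu [mk 13 4, mk 0 1] + evu [mk 0 1, mk 12 13] + evu [mk 12 13, mk 4 0] +
    evu [mk 4 0, mk 1 12] + evu [mk 1 12, mk 13 4]) % 15 = 1 := by decide +kernel

lemma FF_zz : FF zz = 1 := by
  rw [FF_apply]
  simp only [zz, pent, map_add, evu_eq]
  have h := ev_val
  generalize evu [mk 13 4, mk 0 1] + evu [mk 0 1, mk 12 13] + evu [mk 12 13, mk 4 0] +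
    evu [mk 4 0, mk 1 12] + evu [mk 1 12, mk 13 4] = v at *
  have h2 : (v : ZMod 15) = ((1 : ℤ) : ZMod 15) := by
    rw [ZMod.intCast_eq_intCast_iff]
    unfold Int.ModEq
    rw [show ((15 : ℕ) : ℤ) = 15 from rfl, h]; rfl
  simpa using h2

end

end M14

open MatchPaper in
/-- `H̃₄(M₁₄; ℤ)` is a finite group whose exponent is a multiple of `15`;
in particular it contains elements of order `3` and elements of order `5`. -/
theorem five_torsion_in_homology_of_M14 :
    Finite (MH ℤ 14 4) ∧ 15 ∣ AddMonoid.exponent (MH ℤ 14 4) ∧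
      (∃ x : MH ℤ 14 4, addOrderOf x = 3) ∧ (∃ x : MH ℤ 14 4, addOrderOf x = 5) := by
  
  exact M14.final_of_cocycle M14.FF M14.FF_dd M14.zz M14.zz_mem M14.zz_dd (by
    rw [M14.FF_zz]; exact isUnit_one)
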